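/- Let G be a finite group with |G| = |L₃(53)| = 2⁵·3³·7·13²·53³·409 and degree pattern D(G) = D(L₃(53)) = (3,2,1,3,2,1), i.e., deg_G(2)=3, deg_G(3)=2, deg_G(7)=1, deg_G(13)=3, deg_G(53)=2, deg_G(409)=1. Then G is isomorphic to L₃(53). -/

import Mathlib

open scoped MatrixGroups

/-- Two distinct primes `p` and `q` dividing `|G|` are adjacent in the prime graph `Γ(G)`
of a finite group `G` iff `G` has an element of order `p * q`. -/
def primeGraphAdj (G : Type*) [Group G] (p q : ℕ) : Prop :=
  p ≠ q ∧ p.Prime ∧ q.Prime ∧ p ∣ Nat.card G ∧ q ∣ Nat.card G ∧ ∃ g : G, orderOf g = p * q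

open scoped Classical in
/-- The degree of a vertex `p` in the prime graph of `G`: the number of primes dividing `|G|`
that are adjacent to `p`. -/
noncomputable def primeGraphDeg (G : Type*) [Group G] (p : ℕ) : ℕ :=
  ((Nat.card G).primeFactors.filter (fun r => primeGraphAdj G p r)).card


section
open Subgroup MulAction
open scoped Pointwise

namespace OD

/-! ### General lemmas on actions -/

theorem orb_dvd {H α : Type*} [Group H] [MulAction H α] [Finite α] (d : ℕ)
    (h : ∀ a : α, d ∣ Nat.card (orbit H a)) : d ∣ Nat.card α := by
  classical
  rw [Nat.card_congr (selfEquivSigmaOrbits H α)]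
  have : Fintype (Quotient (orbitRel H α)) := Fintype.ofFinite _
  rw [Nat.card_sigma]
  exact Finset.dvd_sum fun ω _ => h _

/-- The sub-action on an invariant set. -/
def subAct {H α : Type*} [Group H] [MulAction H α] (s : Set α)
    (hs : ∀ h : H, ∀ a ∈ s, h • a ∈ s) : SubMulAction H α where
  carrier := s
  smul_mem' := fun h {a} ha => hs h a ha

theorem orb_dvd_set {H α : Type*} [Group H] [MulAction H α] [Finite α] (d : ℕ) (s : Set α)
    (hs : ∀ h : H, ∀ a ∈ s, h • a ∈ s)
    (h : ∀ a ∈ s, d ∣ Nat.card (orbit H a)) : d ∣ s.ncard := by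
  have key : d ∣ Nat.card (subAct s hs) := by
    apply orb_dvd (H := H)
    intro a
    have := SubMulAction.val_image_orbit a
    have h2 : Nat.card (orbit H a) = Nat.card (orbit H (a : α)) := by
      rw [← this, Nat.card_image_of_injective Subtype.val_injective]
    rw [h2]
    exact h a a.2
  exact key

theorem pfix_set {H α : Type*} [Group H] [MulAction H α] [Finite α] (p : ℕ) [Fact p.Prime]
    (hH : IsPGroup p H) (s : Set α) (hs : ∀ h : H, ∀ a ∈ s, h • a ∈ s) :
    s.ncard ≡ {a ∈ s | ∀ h : H, h • a = a}.ncard [MOD p] := by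
  have key := hH.card_modEq_card_fixedPoints (subAct s hs)
  have e : Nat.card (fixedPoints H (subAct s hs)) = {a ∈ s | ∀ h : H, h • a = a}.ncard := by
    have : {a ∈ s | ∀ h : H, h • a = a} = Subtype.val '' (fixedPoints H (subAct s hs)) := by
      ext a
      constructor
      · rintro ⟨h1, h2⟩
        exact ⟨⟨a, h1⟩, fun h => Subtype.ext (h2 h), rfl⟩
      · rintro ⟨b, hb, rfl⟩
        exact ⟨b.2, fun h => congrArg Subtype.val (hb h)⟩
    rw [this, Set.ncard_image_of_injective _ Subtype.val_injective]
    rfl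
  rw [← e]
  exact key

theorem Eq.congr_mod {a b : ℕ} (h : a = b) (p : ℕ) : a ≡ b [MOD p] := h ▸ rfl

theorem fp_conj {G : Type*} [Group G] [Finite G] {p : ℕ} [Fact p.Prime] (H N : Subgroup G)
    (hH : IsPGroup p H) (hN : H ≤ normalizer (N : Set G)) :
    Nat.card N ≡ Nat.card (N ⊓ centralizer (H : Set G) : Subgroup G) [MOD p] := by
  have key := pfix_set (H := (H.map (ConjAct.toConjAct (G := G)).toMonoidHom : Subgroup (ConjAct G))) (α := G) p ?_ (N : Set G) ?_
  · refine Nat.ModEq.trans key ?_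
    refine OD.Eq.congr_mod ?_ p
    change _ = Set.ncard ((N ⊓ centralizer (H : Set G) : Subgroup G) : Set G)
    congr 1
    ext x
    rw [iff_comm]
    simp only [coe_inf, Set.mem_inter_iff, SetLike.mem_coe, mem_centralizer_iff, Set.mem_ofPred_eq]
    apply and_congr_right
    intro _
    constructor
    · rintro h ⟨a, ha⟩
      obtain ⟨b, hb, rfl⟩ := ha
      show b * x * b⁻¹ = x
      rw [h b hb]; group
    · intro h b hb
      have := h ⟨ConjAct.toConjAct b, ⟨b, hb, rfl⟩⟩
      have h2 : b * x * b⁻¹ = x := this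
      calc b * x = (b * x * b⁻¹) * b := by group
        _ = x * b := by rw [h2]
  · exact hH.map _
  · rintro ⟨a, ha⟩ x hx
    obtain ⟨b, hb, rfl⟩ := ha
    exact (mem_normalizer_iff.1 (hN hb) x).1 hx

end OD

end

section
open Subgroup MulAction
open scoped Pointwise

namespace OD

instance fact53 : Fact (Nat.Prime 53) := ⟨by norm_num⟩
instance fact13 : Fact (Nat.Prime 13) := ⟨by norm_num⟩
instance fact409 : Fact (Nat.Prime 409) := ⟨by norm_num⟩

/-- A Sylow subgroup orbit has length `|T| / |T ∩ S|`. -/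
theorem sylow_orbit {G : Type*} [Group G] [Finite G] {p : ℕ} [Fact p.Prime] (T T' : Sylow p G) :
    Nat.card (orbit T T') * Nat.card ((T : Subgroup G) ⊓ T' : Subgroup G) = Nat.card T := by
  have h0 := card_mul_index (stabilizer T T')
  rw [index_stabilizer, mul_comm] at h0
  rw [← h0]
  change _ = Nat.card (orbit T T') * _
  congr 1
  have h1 : stabilizer T T' = ((T : Subgroup G) ⊓ T').subgroupOf T := by
    ext ⟨t, ht⟩
    rw [← T.2.inf_normalizer_sylow T']
    simp only [mem_stabilizer_iff, mem_subgroupOf, mem_inf]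
    change t • T' = T' ↔ _
    rw [Sylow.smul_eq_iff_mem_normalizer]
    exact ⟨fun h => ⟨ht, h⟩, fun h => h.2⟩
  rw [h1]
  exact (Nat.card_congr (subgroupOfEquivOfLe inf_le_left).toEquiv).symm

theorem le_normalizer_sylow {G : Type*} [Group G] {p : ℕ} (K : Subgroup G)
    [Subsingleton (Sylow p K)] (S : Sylow p K) :
    K ≤ normalizer (((S : Subgroup K).map K.subtype : Subgroup G) : Set G) := by
  have hS := Sylow.normal_of_subsingleton S
  have := le_normalizer_map (H := (S : Subgroup K)) K.subtype
  rw [Subgroup.normalizer_eq_top] at this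
  rw [← MonoidHom.range_eq_map, range_subtype] at this
  exact this

theorem arith53 (n : ℕ) (h : n ∣ 2 ^ 5 * 13 ^ 2) (h1 : n % 53 = 1) : n = 1 ∨ n = 2704 := by
  obtain ⟨a, b, ha, hb, rfl⟩ := (Nat.dvd_mul).1 h
  obtain ⟨i, hi, rfl⟩ := (Nat.dvd_prime_pow Nat.prime_two).1 ha
  obtain ⟨j, hj, rfl⟩ := (Nat.dvd_prime_pow fact13.out).1 hb
  interval_cases i <;> interval_cases j <;> simp_all

theorem arith13 (n : ℕ) (h : n ∣ 53 ^ 3 * 2 ^ 5) (h1 : n % 13 = 1) :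
    n = 1 ∨ n % 169 ≠ 1 ∧ 53 ∣ n := by
  obtain ⟨a, b, ha, hb, rfl⟩ := (Nat.dvd_mul).1 h
  obtain ⟨i, hi, rfl⟩ := (Nat.dvd_prime_pow fact53.out).1 ha
  obtain ⟨j, hj, rfl⟩ := (Nat.dvd_prime_pow Nat.prime_two).1 hb
  interval_cases i <;> interval_cases j <;> simp_all

theorem card_sylow_dvd {X : Type*} [Group X] [Finite X] (p : ℕ) [hp : Fact p.Prime] (a b : ℕ)
    (h : Nat.card X ∣ p ^ a * b) : Nat.card (Sylow p X) ∣ b := by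
  have P : Sylow p X := default
  have h1 : Nat.card (Sylow p X) ∣ Nat.card X := by
    rw [P.card_eq_index_normalizer]; exact index_dvd_card _
  have h2 := not_dvd_card_sylow p X
  refine Nat.Coprime.dvd_of_dvd_mul_left (m := p ^ a) ?_ (h1.trans h)
  exact (((Nat.Prime.coprime_iff_not_dvd hp.out).2 h2).symm).pow_right a

theorem card_sylow_mod {X : Type*} [Group X] [Finite X] (p : ℕ) [hp : Fact p.Prime] :
    Nat.card (Sylow p X) % p = 1 := by
  have := card_sylow_modEq_one p X
  rw [Nat.ModEq, Nat.mod_eq_of_lt hp.out.one_lt] at this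
  exact this

theorem subsingleton_of_card_one {α : Type*} (h : Nat.card α = 1) : Subsingleton α :=
  (Nat.card_eq_one_iff_unique.1 h).1

theorem sub_quot {X : Type*} [Group X] [Finite X] (p : ℕ) [hp : Fact p.Prime] (W : Subgroup X)
    [W.Normal] (hW : IsPGroup p W) (h : Subsingleton (Sylow p (X ⧸ W))) :
    Subsingleton (Sylow p X) := by
  refine ⟨fun P P' => ?_⟩
  have hs := QuotientGroup.mk'_surjective W
  have key : P.mapSurjective hs = P'.mapSurjective hs := Subsingleton.elim _ _
  have key2 := congrArg (fun Q : Sylow p (X ⧸ W) => (Q : Subgroup (X ⧸ W)).comap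
    (QuotientGroup.mk' W)) key
  simp only [Sylow.coe_mapSurjective, comap_map_eq, QuotientGroup.ker_mk'] at key2
  rw [sup_eq_left.2 (hW.le_sylow_of_normal P), sup_eq_left.2 (hW.le_sylow_of_normal P')] at key2
  exact Sylow.ext key2

theorem lemA_aux (n : ℕ) : ∀ (X : Type*) [Group X] [Finite X], Nat.card X = n →
    Nat.card X ∣ 53 ^ 3 * (2 ^ 5 * 13 ^ 2) → Subsingleton (Sylow 53 X) := by
  induction n using Nat.strong_induction_on with
  | _ n ih =>
  intro X _ _ hn hd
  by_contra hns
  have ihs : ∀ K : Subgroup X, K ≠ ⊤ → Subsingleton (Sylow 53 K) := by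
    intro K hK
    refine ih (Nat.card K) ?_ K rfl ((card_subgroup_dvd_card K).trans hd)
    rw [← hn]
    refine lt_of_le_of_ne (Nat.le_of_dvd Nat.card_pos (card_subgroup_dvd_card K)) ?_
    intro h
    exact hK (card_eq_iff_eq_top K |>.1 h)
  have hn53 : Nat.card (Sylow 53 X) = 2704 := by
    rcases arith53 _ (card_sylow_dvd 53 3 _ hd) (card_sylow_mod 53) with h | h
    · exact absurd (subsingleton_of_card_one h) hns
    · exact h
  have hX0 : 0 < Nat.card X := Nat.card_pos
  have hNS : ∀ S : Sylow 53 X, ¬ 13 ∣ Nat.card (normalizer (S : Set X)) := by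
    intro S h
    have h1 := S.card_eq_index_normalizer
    have h2 := card_mul_index (normalizer ((S : Subgroup X) : Set X))
    obtain ⟨k, hk⟩ := h
    have hk' : Nat.card (normalizer ((S : Subgroup X) : Set X)) = 13 * k := hk
    have h1' : (normalizer ((S : Subgroup X) : Set X)).index = 2704 := by rw [← hn53, h1]; rfl
    rw [h1', hk'] at h2
    have : 13 ^ 3 ∣ 53 ^ 3 * (2 ^ 5 * 13 ^ 2) := by
      refine dvd_trans ?_ hd
      rw [← h2]
      exact ⟨k * 16, by ring⟩
    norm_num at this
  have h2704 : 2704 ∣ Nat.card X := by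
    have S : Sylow 53 X := default
    rw [← hn53, S.card_eq_index_normalizer]; exact index_dvd_card _
  -- no normal 53-subgroup
  have hO : ∀ W : Subgroup X, W.Normal → IsPGroup 53 W → W = ⊥ := by
    intro W hWn hW
    by_contra hb
    apply hns
    apply sub_quot 53 W hW
    refine ih (Nat.card (X ⧸ W)) ?_ (X ⧸ W) rfl ((card_quotient_dvd_card W).trans hd)
    have h1 := card_eq_card_quotient_mul_card_subgroup W
    have h2 : 1 < Nat.card W := by
      rw [one_lt_card_iff_ne_bot]; exact hb
    have h3 : 0 < Nat.card (X ⧸ W) := Nat.card_pos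
    rw [← hn, h1]
    nlinarith
  have hT : ∀ T : Subgroup X, 13 ∣ Nat.card T → ∀ W : Subgroup X, IsPGroup 53 W → W ≠ ⊥ →
      ¬ T ≤ normalizer (W : Set X) := by
    intro T hT13 W0 hW0 hW0b hTW0
    let s : Set (Subgroup X) := {W | IsPGroup 53 W ∧ W ≠ ⊥ ∧ T ≤ normalizer (W : Set X)}
    obtain ⟨W, ⟨hWp, hWb, hWT⟩, hmax⟩ := Set.exists_max_image s (fun W => Nat.card W)
      (Set.toFinite s) ⟨W0, hW0, hW0b, hTW0⟩
    have hNt : normalizer (W : Set X) ≠ ⊤ := by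
      intro h
      exact hWb (hO W (normalizer_eq_top_iff.1 h) hWp)
    have := ihs _ hNt
    have S' : Sylow 53 (normalizer (W : Set X)) := default
    let W' : Subgroup X := (S' : Subgroup _).map (normalizer (W : Set X)).subtype
    have hNW' : normalizer (W : Set X) ≤ normalizer (W' : Set X) := le_normalizer_sylow _ S'
    have hle : W ≤ W' := by
      have h1 : W.subgroupOf (normalizer (W : Set X)) ≤ S' := by
        have : IsPGroup 53 (W.subgroupOf (normalizer (W : Set X))) := hWp.comap_subtype
        exact this.le_sylow_of_normal S'
      intro w hw
      exact ⟨⟨w, le_normalizer hw⟩, h1 (by simpa [mem_subgroupOf] using hw), rfl⟩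
    have hW'p : IsPGroup 53 W' := S'.2.map _
    have hcard : Nat.card W' ≤ Nat.card W := by
      refine hmax W' ⟨hW'p, ?_, hWT.trans hNW'⟩
      intro h
      exact hWb (le_bot_iff.1 (h ▸ hle))
    have hWW' : W = W' := eq_of_le_of_card_ge hle hcard
    obtain ⟨S, hS⟩ := hWp.exists_le_sylow
    obtain ⟨k, hk⟩ := IsPGroup.iff_card.1 hWp
    obtain ⟨l, hl⟩ := IsPGroup.iff_card.1 S.2
    have hWS : W = S := by
      apply eq_of_le_of_card_ge hS
      rw [hk, hl]
      by_contra hlt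
      have hkl : k < l := by
        by_contra hc
        exact hlt (Nat.pow_le_pow_right (by norm_num) (not_lt.1 hc))
      have h1 : 53 ^ (k + 1) ∣ Nat.card X :=
        (pow_dvd_pow 53 hkl).trans (hl ▸ card_subgroup_dvd_card (S : Subgroup X))
      have h2 := Sylow.prime_pow_dvd_card_normalizer h1 hk
      have h3 := S'.pow_dvd_card_of_pow_dvd_card h2
      have h4 : Nat.card S' = 53 ^ k := by
        rw [← hk]
        refine Eq.trans ?_ (congrArg (fun Y : Subgroup X => Nat.card Y) hWW').symm
        exact (Nat.card_congr ((S' : Subgroup (normalizer (W : Set X))).equivMapOfInjective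
          (normalizer (W : Set X)).subtype (subtype_injective _)).toEquiv)
      rw [h4] at h3
      have := (Nat.pow_dvd_pow_iff_le_right (x := 53) (by norm_num)).1 h3
      omega
    apply hNS S
    have : T ≤ normalizer ((S : Subgroup X) : Set X) := hWS ▸ hWT
    exact hT13.trans (card_dvd_of_le this)
  have hd13 : Nat.card X ∣ 13 ^ 2 * (53 ^ 3 * 2 ^ 5) := hd.trans (by norm_num)
  have cT : ∀ T : Sylow 13 X, Nat.card T = 13 ^ 2 := by
    intro T
    have h1 : 13 ^ 2 ∣ Nat.card T := T.pow_dvd_card_of_pow_dvd_card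
      (dvd_trans (by norm_num) h2704)
    obtain ⟨l, hl⟩ := IsPGroup.iff_card.1 T.2
    have h3 : 13 ^ l ∣ 13 ^ 2 * (53 ^ 3 * 2 ^ 5) := hl ▸ (card_subgroup_dvd_card _).trans hd13
    have h4 : 13 ^ l ∣ 13 ^ 2 := Nat.Coprime.dvd_of_dvd_mul_right
      (Nat.Coprime.pow_left _ (by norm_num)) h3
    exact Nat.dvd_antisymm (hl ▸ h4) h1
  have hCS : ∀ S : Sylow 53 X, ∀ D : Subgroup X, 13 ∣ Nat.card D →
      ¬ D ≤ centralizer ((S : Subgroup X) : Set X) := by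
    intro S D hD h
    exact hNS S (hD.trans (card_dvd_of_le (h.trans (centralizer_le_normalizer _))))
  have T : Sylow 13 X := default
  rcases arith13 _ (card_sylow_dvd 13 2 _ hd13) (card_sylow_mod 13) with h | ⟨h, -⟩
  · have := subsingleton_of_card_one h
    have hTn := Sylow.normal_of_subsingleton T
    have S : Sylow 53 X := default
    have h1 := fp_conj (S : Subgroup X) (T : Subgroup X) S.2
      (by rw [normalizer_eq_top]; exact le_top)
    refine hCS S _ ?_ (inf_le_right (a := (T : Subgroup X)))
    have h2 : Nat.card ((T : Subgroup X) ⊓ centralizer ((S : Subgroup X) : Set X) : Subgroup X) ∣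
        13 ^ 2 := by rw [← cT T]; exact card_dvd_of_le inf_le_left
    obtain ⟨i, hi, hi2⟩ := (Nat.dvd_prime_pow fact13.out).1 h2
    rw [cT T, hi2] at h1
    rw [hi2]
    rcases i with _ | i
    · exact absurd h1 (by decide)
    · exact Dvd.intro_left (13 ^ i) rfl
  · have hex : ∃ T' : Sylow 13 X, T' ≠ T ∧ (T : Subgroup X) ⊓ T' ≠ ⊥ := by
      by_contra hno
      push Not at hno
      have h1 := orb_dvd_set (H := T) 169 ({T}ᶜ : Set (Sylow 13 X)) ?_ ?_
      · rw [Set.ncard_compl, Set.ncard_singleton] at h1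
        have : 0 < Nat.card (Sylow 13 X) := Nat.card_pos
        omega
      · intro t A hA hA2
        apply hA
        have h3 : t⁻¹ • (t • A) = t⁻¹ • T := by rw [hA2]
        rw [inv_smul_smul] at h3
        rw [h3]
        exact Sylow.smul_eq_iff_mem_normalizer.2 (le_normalizer (inv_mem t.2))
      · intro A hA
        have h3 := sylow_orbit T A
        rw [hno A hA, cT, card_bot, mul_one] at h3
        rw [h3]
        norm_num
    obtain ⟨T', hT', hD⟩ := hex
    have hcomm : ∀ A : Sylow 13 X, ∀ a ∈ (A : Subgroup X), ∀ b ∈ (A : Subgroup X),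
        a * b = b * a := by
      intro A a ha b hb
      have := IsPGroup.isMulCommutative_of_card_eq_prime_sq (cT A)
      exact congrArg Subtype.val (mul_comm' (⟨a, ha⟩ : (A : Subgroup X)) ⟨b, hb⟩)
    set D := (T : Subgroup X) ⊓ T' with hDdef
    have hTC : (T : Subgroup X) ≤ centralizer (D : Set X) := fun a ha =>
      mem_centralizer_iff.2 fun b hb => hcomm T b hb.1 a ha
    have hTC' : (T' : Subgroup X) ≤ centralizer (D : Set X) := fun a ha =>
      mem_centralizer_iff.2 fun b hb => hcomm T' b hb.2 a ha
    have hD13 : 13 ∣ Nat.card D := by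
      have h2 : Nat.card D ∣ 13 ^ 2 := by rw [← cT T]; exact card_dvd_of_le inf_le_left
      obtain ⟨i, hi, hi2⟩ := (Nat.dvd_prime_pow fact13.out).1 h2
      rw [hi2]
      rcases i with _ | i
      · exact absurd (card_eq_one.1 hi2) hD
      · exact Dvd.intro_left (13 ^ i) rfl
    have hCt : centralizer (D : Set X) ≠ ⊤ := by
      intro h
      have S : Sylow 53 X := default
      apply hCS S D hD13
      intro d hd
      rw [mem_centralizer_iff]
      intro s hs
      have : s ∈ centralizer (D : Set X) := h ▸ mem_top s
      exact (mem_centralizer_iff.1 this d hd).symm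
    have hss := ihs _ hCt
    have S1 : Sylow 53 (centralizer (D : Set X)) := default
    refine hT T ?_ ((S1 : Subgroup _).map (centralizer (D : Set X)).subtype) (S1.2.map _) ?_
      (hTC.trans (le_normalizer_sylow _ S1))
    · rw [cT]; norm_num
    intro hbot
    have hS1 : (S1 : Subgroup (centralizer (D : Set X))) = ⊥ :=
      (map_eq_bot_iff_of_injective _ (subtype_injective _)).1 hbot
    have h53 : 53 ∣ Nat.card (centralizer (D : Set X)) := by
      rcases arith13 _ (card_sylow_dvd 13 2 _ ((card_subgroup_dvd_card _).trans hd13))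
        (card_sylow_mod (X := centralizer (D : Set X)) 13) with h | ⟨-, h⟩
      · have := subsingleton_of_card_one h
        have : T.subtype hTC = T'.subtype hTC' := Subsingleton.elim _ _
        exact absurd (Sylow.subtype_injective this).symm hT'
      · refine h.trans ?_
        have A : Sylow 13 (centralizer (D : Set X)) := default
        rw [A.card_eq_index_normalizer]; exact index_dvd_card _
    have h4 := S1.dvd_card_of_dvd_card h53
    have h5 : Nat.card S1 = 1 := by rw [hS1]; exact card_bot
    rw [h5] at h4
    norm_num at h4

theorem lemA (X : Type*) [Group X] [Finite X]
    (h : Nat.card X ∣ 53 ^ 3 * (2 ^ 5 * 13 ^ 2)) : Subsingleton (Sylow 53 X) :=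
  lemA_aux _ X rfl h
end OD

end

section
open Subgroup MulAction
open scoped Pointwise

namespace OD

instance fact7 : Fact (Nat.Prime 7) := ⟨by norm_num⟩
instance fact3 : Fact (Nat.Prime 3) := ⟨by norm_num⟩

theorem adj_of_comm {G : Type*} [Group G] [Finite G] {p q : ℕ} (hp : p.Prime) (hq : q.Prime)
    (hpq : p ≠ q) (x y : G) (hx : orderOf x = p) (hy : orderOf y = q) (h : x * y = y * x) :
    primeGraphAdj G p q := by
  refine ⟨hpq, hp, hq, hx ▸ orderOf_dvd_natCard x, hy ▸ orderOf_dvd_natCard y, x * y, ?_⟩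
  have h1 : Commute x y := h
  rw [h1.orderOf_mul_eq_mul_orderOf_of_coprime, hx, hy]
  rw [hx, hy]
  exact (Nat.coprime_primes hp hq).2 hpq

theorem comm_of_adj {G : Type*} [Group G] [Finite G] {p q : ℕ} (h : primeGraphAdj G p q) :
    ∃ x y : G, orderOf x = p ∧ orderOf y = q ∧ x * y = y * x := by
  obtain ⟨-, hp, hq, -, -, g, hg⟩ := h
  refine ⟨g ^ q, g ^ p, ?_, ?_, ?_⟩
  · rw [orderOf_pow_of_dvd hq.ne_zero (hg ▸ dvd_mul_left _ _), hg, Nat.mul_div_cancel _ hq.pos]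
  · rw [orderOf_pow_of_dvd hp.ne_zero (hg ▸ dvd_mul_right _ _), hg, Nat.mul_div_cancel_left _ hp.pos]
  · rw [← pow_add, ← pow_add, add_comm]

theorem adj_symm {G : Type*} [Group G] {p q : ℕ} (h : primeGraphAdj G p q) :
    primeGraphAdj G q p := by
  obtain ⟨h1, hp, hq, h2, h3, g, hg⟩ := h
  exact ⟨h1.symm, hq, hp, h3, h2, g, by rw [hg, mul_comm]⟩

open scoped Classical in
theorem deg_sum {G : Type*} [Group G] [Finite G]
    (hcard : Nat.card G = 2 ^ 5 * 3 ^ 3 * 7 * 13 ^ 2 * 53 ^ 3 * 409) (p : ℕ) :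
    primeGraphDeg G p = (if primeGraphAdj G p 2 then 1 else 0) +
      ((if primeGraphAdj G p 3 then 1 else 0) + ((if primeGraphAdj G p 7 then 1 else 0) +
      ((if primeGraphAdj G p 13 then 1 else 0) + ((if primeGraphAdj G p 53 then 1 else 0) +
      (if primeGraphAdj G p 409 then 1 else 0))))) := by
  have h : (Nat.card G).primeFactors = {2, 3, 7, 13, 53, 409} := by
    rw [hcard]
    have p7 : Nat.primeFactors 7 = {7} := Nat.Prime.primeFactors (by norm_num)
    have p409 : Nat.primeFactors 409 = {409} := Nat.Prime.primeFactors (by norm_num)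
    rw [Nat.primeFactors_mul (by norm_num) (by norm_num), Nat.primeFactors_mul (by norm_num) (by norm_num),
      Nat.primeFactors_mul (by norm_num) (by norm_num), Nat.primeFactors_mul (by norm_num) (by norm_num),
      Nat.primeFactors_mul (by norm_num) (by norm_num),
      Nat.primeFactors_prime_pow (by norm_num) (by norm_num),
      Nat.primeFactors_prime_pow (by norm_num) (by norm_num),
      Nat.primeFactors_prime_pow (by norm_num) (by norm_num),
      Nat.primeFactors_prime_pow (by norm_num) (by norm_num), p7, p409]
    rfl
  unfold primeGraphDeg
  rw [h, Finset.card_filter]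
  rw [Finset.sum_insert (by simp), Finset.sum_insert (by simp), Finset.sum_insert (by simp),
    Finset.sum_insert (by simp), Finset.sum_insert (by simp), Finset.sum_singleton]

theorem arith409 (c e n r k : ℕ) (hr : r.Prime) (hc : c = r ^ k)
    (h : n * (c * e) = 2 ^ 5 * 3 ^ 3 * 7 * 13 ^ 2 * 53 ^ 3) (hn : n % 409 = 1) (he : e ∣ 408) :
    c = 7 ∧ e = 3 := by
  have h1 : (c * e) % 409 = 21 := by
    have := congrArg (· % 409) h
    simp only [Nat.mul_mod n, hn] at this
    norm_num at this
    omega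
  have he2 : e ∣ 24 := by
    have h3 : e ∣ 2 ^ 5 * 3 ^ 3 * 7 * 13 ^ 2 * 53 ^ 3 := ⟨n * c, by rw [← h]; ring⟩
    exact (Nat.dvd_gcd h3 he).trans (by norm_num)
  have he3 : e ∈ Nat.divisors 24 := Nat.mem_divisors.2 ⟨he2, by norm_num⟩
  have he4 : e ∈ ({1, 2, 3, 4, 6, 8, 12, 24} : Finset ℕ) := by
    have : Nat.divisors 24 = {1, 2, 3, 4, 6, 8, 12, 24} := by decide
    rwa [this] at he3
  rcases k with _ | k
  · simp at hc
    subst hc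
    simp at he4
    omega
  have hcd : r ^ (k + 1) ∣ 2 ^ 5 * 3 ^ 3 * 7 * 13 ^ 2 * 53 ^ 3 := ⟨n * e, by rw [← h, hc]; ring⟩
  have hrd : r ∣ 2 ^ 5 * 3 ^ 3 * 7 * 13 ^ 2 * 53 ^ 3 := (dvd_pow_self r (by omega)).trans hcd
  have hr5 : r = 2 ∨ r = 3 ∨ r = 7 ∨ r = 13 ∨ r = 53 := by
    rcases (Nat.Prime.dvd_mul hr).1 hrd with h | h
    · rcases (Nat.Prime.dvd_mul hr).1 h with h | h
      · rcases (Nat.Prime.dvd_mul hr).1 h with h | h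
        · rcases (Nat.Prime.dvd_mul hr).1 h with h | h
          · exact Or.inl ((Nat.prime_dvd_prime_iff_eq hr (by norm_num)).1 (hr.dvd_of_dvd_pow h))
          · exact Or.inr (Or.inl ((Nat.prime_dvd_prime_iff_eq hr (by norm_num)).1 (hr.dvd_of_dvd_pow h)))
        · exact Or.inr (Or.inr (Or.inl ((Nat.prime_dvd_prime_iff_eq hr (by norm_num)).1 h)))
      · exact Or.inr (Or.inr (Or.inr (Or.inl ((Nat.prime_dvd_prime_iff_eq hr (by norm_num)).1 (hr.dvd_of_dvd_pow h)))))
    · exact Or.inr (Or.inr (Or.inr (Or.inr ((Nat.prime_dvd_prime_iff_eq hr (by norm_num)).1 (hr.dvd_of_dvd_pow h)))))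
  have hk : k < 5 := by
    by_contra hk
    have : r ^ 6 ∣ 2 ^ 5 * 3 ^ 3 * 7 * 13 ^ 2 * 53 ^ 3 := (pow_dvd_pow r (by omega)).trans hcd
    rcases hr5 with h | h | h | h | h <;> subst h <;> norm_num at this
  simp only [Finset.mem_insert, Finset.mem_singleton] at he4
  rcases hr5 with h | h | h | h | h <;> subst h <;> interval_cases k <;> norm_num at hc hcd <;>
    subst hc <;> omega

/-- The consequences of the hypotheses that are used later. -/
structure Hyp (G : Type*) [Group G] [Finite G] : Prop where
  card : Nat.card G = 2 ^ 5 * 3 ^ 3 * 7 * 13 ^ 2 * 53 ^ 3 * 409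
  n409 : ∀ Q : Sylow 409 G, Nat.card (normalizer ((Q : Subgroup G) : Set G)) = 8589
  no53 : ∀ r, (r = 3 ∨ r = 7 ∨ r = 409) → ∀ x y : G, orderOf x = r → orderOf y = 53 →
    x * y ≠ y * x
  no409 : ∀ r, (r = 2 ∨ r = 13) → ∀ x y : G, orderOf x = r → orderOf y = 409 →
    x * y ≠ y * x
  adj : ∃ x y : G, orderOf x = 13 ∧ orderOf y = 53 ∧ x * y = y * x

theorem sylow_card_pow {G : Type*} [Group G] [Finite G] (p : ℕ) [hp : Fact p.Prime] (a b : ℕ)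
    (h : Nat.card G = p ^ a * b) (hb : ¬ p ∣ b) (P : Sylow p G) : Nat.card P = p ^ a := by
  obtain ⟨l, hl⟩ := IsPGroup.iff_card.1 P.2
  have h1 : p ^ a ∣ Nat.card P := P.pow_dvd_card_of_pow_dvd_card (h ▸ dvd_mul_right _ _)
  have h3 : p ^ l ∣ p ^ a * b := by rw [← hl, ← h]; exact card_subgroup_dvd_card _
  have h4 : p ^ l ∣ p ^ a := Nat.Coprime.dvd_of_dvd_mul_right
      (Nat.Coprime.pow_left _ ((Nat.Prime.coprime_iff_not_dvd hp.out).2 hb)) h3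
  exact Nat.dvd_antisymm (hl ▸ h4) h1

theorem norm_cent {G : Type*} [Group G] [Finite G] (p : ℕ) [hp : Fact p.Prime] (Q : Subgroup G)
    (hQ : Nat.card Q = p) : ∃ e, e ∣ p - 1 ∧ Nat.card (normalizer (Q : Set G)) =
      Nat.card (centralizer (Q : Set G)) * e := by
  have hc : IsCyclic Q := isCyclic_of_prime_card hQ
  let f := Q.normalizerMonoidHom
  have h1 := card_mul_index f.ker
  refine ⟨f.ker.index, ?_, ?_⟩
  · rw [index_ker]
    have h2 := card_subgroup_dvd_card f.range
    rw [IsCyclic.card_mulAut, hQ, Nat.totient_prime hp.out] at h2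
    exact h2
  · rw [← h1]
    congr 1
    rw [normalizerMonoidHom_ker]
    exact Nat.card_congr (subgroupOfEquivOfLe (centralizer_le_normalizer _)).toEquiv

theorem mkHyp {G : Type*} [Group G] [Finite G]
    (hcard : Nat.card G = 2 ^ 5 * 3 ^ 3 * 7 * 13 ^ 2 * 53 ^ 3 * 409)
    (hdeg2 : primeGraphDeg G 2 = 3)
    (hdeg3 : primeGraphDeg G 3 = 2)
    (hdeg7 : primeGraphDeg G 7 = 1)
    (hdeg13 : primeGraphDeg G 13 = 3)
    (hdeg409 : primeGraphDeg G 409 = 1) : Hyp G := by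
  classical
  have key : ∀ Q : Sylow 409 G, primeGraphAdj G 409 7 ∧
      Nat.card (normalizer ((Q : Subgroup G) : Set G)) = 8589 := by
    intro Q
    have hQ : Nat.card Q = 409 := by
      have := sylow_card_pow 409 1 _ (by rw [hcard, mul_comm, pow_one]) (by norm_num) Q
      simpa using this
    obtain ⟨e, he, hN⟩ := norm_cent 409 (Q : Subgroup G) hQ
    have hcyc : IsCyclic (Q : Subgroup G) := isCyclic_of_prime_card hQ
    have hQC : (Q : Subgroup G) ≤ centralizer ((Q : Subgroup G) : Set G) := by
      intro a ha
      rw [mem_centralizer_iff]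
      intro b hb
      exact congrArg Subtype.val (mul_comm' (⟨b, hb⟩ : (Q : Subgroup G)) ⟨a, ha⟩)
    obtain ⟨c, hc⟩ := card_dvd_of_le hQC
    rw [hQ] at hc
    have h1 := Q.card_eq_index_normalizer
    have h2 := card_mul_index (normalizer ((Q : Subgroup G) : Set G))
    have h1' : (normalizer ((Q : Subgroup G) : Set G)).index = Nat.card (Sylow 409 G) := by
      rw [h1]; rfl
    rw [h1', hN, hc, hcard] at h2
    have h3 : Nat.card (Sylow 409 G) * (c * e) = 2 ^ 5 * 3 ^ 3 * 7 * 13 ^ 2 * 53 ^ 3 := by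
      have : 409 * (Nat.card (Sylow 409 G) * (c * e)) = 409 * (2 ^ 5 * 3 ^ 3 * 7 * 13 ^ 2 * 53 ^ 3) := by
        linarith
      exact Nat.eq_of_mul_eq_mul_left (by norm_num) this
    have hcadj : ∀ r, r.Prime → r ∣ c → primeGraphAdj G 409 r := by
      intro r hr hrc
      have : Fact r.Prime := ⟨hr⟩
      obtain ⟨⟨x, hx⟩, hx2⟩ := exists_prime_orderOf_dvd_card' (G := centralizer ((Q : Subgroup G) : Set G)) r
        (by rw [hc]; exact hrc.mul_left _)
      obtain ⟨⟨y, hy⟩, hy2⟩ := exists_prime_orderOf_dvd_card' (G := (Q : Subgroup G)) 409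
        (by rw [hQ])
      rw [orderOf_mk] at hx2 hy2
      refine adj_of_comm (by norm_num) hr ?_ y x hy2 hx2 (mem_centralizer_iff.1 hx y hy)
      rintro rfl
      have : 409 ∣ 2 ^ 5 * 3 ^ 3 * 7 * 13 ^ 2 * 53 ^ 3 := by
        rw [← h3]; exact (hrc.mul_right _).mul_left _
      norm_num at this
    have huniq : ∃ r k, r.Prime ∧ c = r ^ k := by
      by_cases hc1 : c = 1
      · exact ⟨2, 0, Nat.prime_two, by simpa using hc1⟩
      obtain ⟨r, hr, hrc⟩ := Nat.exists_prime_and_dvd hc1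
      have hc0 : c ≠ 0 := by
        rintro rfl
        simp at h3
      refine ⟨r, _, hr, Nat.eq_prime_pow_of_unique_prime_dvd hc0 ?_⟩
      intro d hd hdc
      unfold primeGraphDeg at hdeg409
      obtain ⟨z, hz⟩ := Finset.card_eq_one.1 hdeg409
      have hmem : ∀ r, r.Prime → r ∣ c → r = z := by
        intro r hr hrc
        rw [← Finset.mem_singleton, ← hz, Finset.mem_filter]
        have := hcadj r hr hrc
        exact ⟨Nat.mem_primeFactors.2 ⟨hr, this.2.2.2.2.1, by rw [hcard]; norm_num⟩, this⟩
      rw [hmem d hd hdc, hmem r hr hrc]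
    obtain ⟨r, k, hr, hrk⟩ := huniq
    obtain ⟨hc7, he3⟩ := arith409 c e _ r k hr hrk h3 (card_sylow_mod 409) he
    refine ⟨hcadj 7 (by norm_num) (by rw [hc7]), ?_⟩
    rw [hN, hc, hc7, he3]
  have a409 : primeGraphAdj G 409 7 := (key default).1
  have irr : ∀ p, ¬ primeGraphAdj G p p := fun p h => h.1 rfl
  have a7 := adj_symm a409
  rw [deg_sum hcard] at hdeg2 hdeg3 hdeg7 hdeg13 hdeg409
  have b1 : ¬ primeGraphAdj G 409 2 := by
    intro h
    rw [if_pos a409, if_pos h] at hdeg409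
    omega
  have b2 : ¬ primeGraphAdj G 409 3 := by
    intro h
    rw [if_pos a409, if_pos h] at hdeg409
    omega
  have b3 : ¬ primeGraphAdj G 409 13 := by
    intro h
    rw [if_pos a409, if_pos h] at hdeg409
    omega
  have b4 : ¬ primeGraphAdj G 409 53 := by
    intro h
    rw [if_pos a409, if_pos h] at hdeg409
    omega
  have c1 : ¬ primeGraphAdj G 7 2 := by
    intro h
    rw [if_pos a7, if_pos h] at hdeg7
    omega
  have c2 : ¬ primeGraphAdj G 7 13 := by
    intro h
    rw [if_pos a7, if_pos h] at hdeg7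
    omega
  have c3 : ¬ primeGraphAdj G 7 53 := by
    intro h
    rw [if_pos a7, if_pos h] at hdeg7
    omega
  have d1 : primeGraphAdj G 13 53 := by
    by_contra h
    rw [if_neg h, if_neg (irr 13), if_neg (fun h => c2 (adj_symm h)), if_neg (fun h => b3 (adj_symm h))] at hdeg13
    split_ifs at hdeg13 <;> omega
  have d2 : primeGraphAdj G 13 3 := by
    by_contra h
    rw [if_neg h, if_neg (irr 13), if_neg (fun h => c2 (adj_symm h)), if_neg (fun h => b3 (adj_symm h))] at hdeg13
    split_ifs at hdeg13 <;> omega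
  have d3 : primeGraphAdj G 2 3 := by
    by_contra h
    rw [if_neg h, if_neg (irr 2), if_neg (fun h => c1 (adj_symm h)), if_neg (fun h => b1 (adj_symm h))] at hdeg2
    split_ifs at hdeg2 <;> omega
  have e1 : ¬ primeGraphAdj G 3 53 := by
    intro h
    rw [if_pos h, if_pos (adj_symm d2), if_pos (adj_symm d3)] at hdeg3
    omega
  refine ⟨hcard, fun Q => (key Q).2, ?_, ?_, comm_of_adj d1⟩
  · rintro r hr x y hx hy h
    have hrp : r.Prime := by rcases hr with rfl | rfl | rfl <;> norm_num
    have := adj_of_comm hrp (q := 53) (by norm_num) (by omega) x y hx hy h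
    rcases hr with rfl | rfl | rfl
    · exact e1 this
    · exact c3 this
    · exact b4 this
  · rintro r hr x y hx hy h
    have hrp : r.Prime := by rcases hr with rfl | rfl <;> norm_num
    have := adj_symm (adj_of_comm hrp (q := 409) (by norm_num) (by omega) x y hx hy h)
    rcases hr with rfl | rfl
    · exact b1 this
    · exact b3 this
end OD

end

section
open Subgroup MulAction
open scoped Pointwise

namespace OD

section
set_option linter.unusedSectionVars false
variable {G : Type*} [Group G] [Finite G]

theorem frattini (H : Hyp G) (N : Subgroup G) [N.Normal] (h : 409 ∣ Nat.card N) :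
    N.index ∣ 8589 := by
  have Q : Sylow 409 N := default
  have h1 := Sylow.normalizer_sup_eq_top Q
  obtain ⟨Q', hQ'⟩ := (Q.2.map N.subtype).exists_le_sylow
  have hc' : Nat.card Q' = 409 ^ 1 := sylow_card_pow 409 1 _ (by rw [H.card, mul_comm, pow_one]) (by norm_num) Q'
  have h3 : 409 ∣ Nat.card Q := Q.dvd_card_of_dvd_card h
  have h4 : Nat.card ((Q : Subgroup N).map N.subtype) = Nat.card Q :=
    (Nat.card_congr ((Q : Subgroup N).equivMapOfInjective N.subtype (subtype_injective _)).toEquiv).symm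
  have h5 : (Q : Subgroup N).map N.subtype = Q' := by
    apply eq_of_le_of_card_ge hQ'
    rw [hc', h4]
    exact Nat.le_of_dvd Nat.card_pos (by simpa using h3)
  rw [h5] at h1
  have h6 := H.n409 Q'
  rw [← h6, ← relIndex_top_right, ← h1, relIndex_sup_right]
  exact relIndex_dvd_card _ _

theorem cardP (H : Hyp G) (P : Sylow 53 G) : Nat.card P = 53 ^ 3 :=
  sylow_card_pow 53 3 (2 ^ 5 * 3 ^ 3 * 7 * 13 ^ 2 * 409) (by rw [H.card]; norm_num) (by norm_num) P

theorem sylow_of_card (H : Hyp G) (W : Subgroup G) (hW : Nat.card W = 53 ^ 3) :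
    ∃ P : Sylow 53 G, (P : Subgroup G) = W := by
  obtain ⟨P, hP⟩ := (IsPGroup.of_card hW).exists_le_sylow
  exact ⟨P, (eq_of_le_of_card_ge hP (by rw [hW]; exact (cardP H P).le)).symm⟩

/-- subgroups which are `{2, 13, 53}`-groups -/
def Good (X : Subgroup G) : Prop := Nat.card X ∣ 53 ^ 3 * (2 ^ 5 * 13 ^ 2)

theorem good_of (H : Hyp G) (X : Subgroup G) (h3 : ¬ 3 ∣ Nat.card X) (h7 : ¬ 7 ∣ Nat.card X)
    (h409 : ¬ 409 ∣ Nat.card X) : Good X := by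
  have h1 : Nat.card X ∣ 53 ^ 3 * (2 ^ 5 * 13 ^ 2) * (3 ^ 3 * 7 * 409) := by
    rw [show 53 ^ 3 * (2 ^ 5 * 13 ^ 2) * (3 ^ 3 * 7 * 409) = Nat.card G by rw [H.card]; norm_num]
    exact card_subgroup_dvd_card X
  refine Nat.Coprime.dvd_of_dvd_mul_right ?_ h1
  refine Nat.Coprime.mul_right (Nat.Coprime.mul_right (Nat.Coprime.pow_right _ ?_) ?_) ?_
  · exact ((Nat.Prime.coprime_iff_not_dvd (by norm_num)).2 h3).symm
  · exact ((Nat.Prime.coprime_iff_not_dvd (by norm_num)).2 h7).symm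
  · exact ((Nat.Prime.coprime_iff_not_dvd (by norm_num)).2 h409).symm

theorem cauchy_mem (p : ℕ) [Fact p.Prime] (X : Subgroup G) (h : p ∣ Nat.card X) :
    ∃ x ∈ X, orderOf x = p := by
  obtain ⟨⟨x, hx⟩, hx2⟩ := exists_prime_orderOf_dvd_card' (G := X) p h
  rw [orderOf_mk] at hx2
  exact ⟨x, hx, hx2⟩

theorem cent_not_dvd (H : Hyp G) (U : Subgroup G) (hU : 53 ∣ Nat.card U) (r : ℕ)
    (hr : r = 3 ∨ r = 7 ∨ r = 409) : ¬ r ∣ Nat.card (centralizer (U : Set G)) := by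
  intro h
  have : Fact r.Prime := ⟨by rcases hr with rfl | rfl | rfl <;> norm_num⟩
  obtain ⟨x, hx, hx2⟩ := cauchy_mem r _ h
  obtain ⟨y, hy, hy2⟩ := cauchy_mem 53 _ hU
  exact H.no53 r hr x y hx2 hy2 (mem_centralizer_iff.1 hx y hy).symm

theorem good_cent (H : Hyp G) (U : Subgroup G) (hU : 53 ∣ Nat.card U) :
    Good (centralizer (U : Set G)) :=
  good_of H _ (cent_not_dvd H U hU 3 (by simp)) (cent_not_dvd H U hU 7 (by simp))
    (cent_not_dvd H U hU 409 (by simp))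

theorem good_norm (H : Hyp G) (U : Subgroup G) (hU : Nat.card U = 53) :
    Good (normalizer (U : Set G)) := by
  obtain ⟨e, he, hN⟩ := norm_cent 53 U hU
  have key : ∀ r, (r = 3 ∨ r = 7 ∨ r = 409) → ¬ r ∣ Nat.card (normalizer (U : Set G)) := by
    intro r hr h
    have hrp : r.Prime := by rcases hr with rfl | rfl | rfl <;> norm_num
    rw [hN] at h
    rcases (Nat.Prime.dvd_mul hrp).1 h with h | h
    · exact cent_not_dvd H U (by rw [hU]) r hr h
    · have := h.trans he
      rcases hr with rfl | rfl | rfl <;> norm_num at this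
  exact good_of H _ (key 3 (by simp)) (key 7 (by simp)) (key 409 (by simp))

theorem lemB {X : Subgroup G} (hX : Good X) (P P' : Sylow 53 G) (h : (P : Subgroup G) ≤ X)
    (h' : (P' : Subgroup G) ≤ X) : P = P' := by
  have := lemA X hX
  have : P.subtype h = P'.subtype h' := Subsingleton.elim _ _
  exact Sylow.subtype_injective this

theorem three_not_norm (H : Hyp G) (P : Sylow 53 G) :
    ¬ 3 ∣ Nat.card (normalizer ((P : Subgroup G) : Set G)) := by
  intro h
  obtain ⟨x, hx, hx2⟩ := cauchy_mem 3 _ h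
  have hz : IsPGroup 3 (zpowers x) := IsPGroup.of_card (n := 1) (by rw [Nat.card_zpowers, hx2, pow_one])
  have h1 := fp_conj (zpowers x) (P : Subgroup G) hz (by rw [zpowers_le]; exact hx)
  rw [cardP H] at h1
  set Y := (P : Subgroup G) ⊓ centralizer ((zpowers x : Subgroup G) : Set G) with hY
  have h2 : Nat.card Y ∣ 53 ^ 3 := by rw [← cardP H P]; exact card_dvd_of_le inf_le_left
  obtain ⟨i, hi, hi2⟩ := (Nat.dvd_prime_pow fact53.out).1 h2
  have h53 : 53 ∣ Nat.card Y := by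
    rw [hi2]
    rcases i with _ | i
    · rw [hi2] at h1
      exact absurd h1 (by decide)
    · exact Dvd.intro_left _ rfl
  obtain ⟨y, hy, hy2⟩ := cauchy_mem 53 _ h53
  exact H.no53 3 (by simp) x y hx2 hy2 (mem_centralizer_iff.1 hy.2 x (mem_zpowers x))

theorem card_np (H : Hyp G) (P : Sylow 53 G) :
    Nat.card (Sylow 53 G) * Nat.card (normalizer ((P : Subgroup G) : Set G)) =
      2 ^ 5 * 3 ^ 3 * 7 * 13 ^ 2 * 53 ^ 3 * 409 := by
  have h1 := P.card_eq_index_normalizer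
  have h2 := card_mul_index (normalizer ((P : Subgroup G) : Set G))
  have h1' : (normalizer ((P : Subgroup G) : Set G)).index = Nat.card (Sylow 53 G) := by
    rw [h1]; rfl
  rw [h1', H.card] at h2
  rw [← h2, mul_comm]

theorem grow {U K P : Subgroup G} (hU : Nat.card U = 53 ^ 2) (hP : Nat.card P = 53 ^ 3)
    (h1 : U ≤ K) (h2 : K ≤ P) : K = U ∨ K = P := by
  obtain ⟨i, hi, hi2⟩ := (Nat.dvd_prime_pow fact53.out).1 (hP ▸ card_dvd_of_le h2)
  have h3 := card_dvd_of_le h1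
  rw [hU, hi2] at h3
  have h4 := (Nat.pow_dvd_pow_iff_le_right (x := 53) (by norm_num)).1 h3
  have : i = 2 ∨ i = 3 := by omega
  rcases this with rfl | rfl
  · exact Or.inl (eq_of_le_of_card_ge h1 (by rw [hi2, hU])).symm
  · exact Or.inr (eq_of_le_of_card_ge h2 (by rw [hi2, hP]))

theorem ab_of {U P : Subgroup G} (hU : Nat.card U = 53 ^ 2) (hP : Nat.card P = 53 ^ 3)
    (hUP : U ≤ P) (h : P ≤ centralizer (U : Set G)) : P ≤ centralizer (P : Set G) := by
  intro b hb
  rw [mem_centralizer_iff]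
  intro a ha
  have hbU := mem_centralizer_iff.1 (h hb)
  by_cases haU : a ∈ U
  · exact hbU a haU
  have hUab : U ≤ centralizer (U : Set G) := hUP.trans h
  rcases grow (K := P ⊓ centralizer ({a} : Set G)) hU hP (le_inf hUP fun u hu => by
    rw [mem_centralizer_iff]
    rintro _ rfl
    exact (mem_centralizer_iff.1 (h ha) u hu).symm) inf_le_left with h1 | h1
  · have h2 : a ∈ P ⊓ centralizer ({a} : Set G) :=
      mem_inf.2 ⟨ha, mem_centralizer_iff.2 (by rintro _ rfl; rfl)⟩
    rw [h1] at h2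
    exact absurd h2 haU
  · have : b ∈ P ⊓ centralizer ({a} : Set G) := by rw [h1]; exact hb
    exact mem_centralizer_iff.1 this.2 a rfl

theorem ab_conj (P P' : Sylow 53 G) (h : (P : Subgroup G) ≤ centralizer ((P : Subgroup G) : Set G)) :
    (P' : Subgroup G) ≤ centralizer ((P' : Subgroup G) : Set G) := by
  obtain ⟨g, rfl⟩ := exists_smul_eq G P P'
  intro a ha
  rw [mem_centralizer_iff]
  intro b hb
  rw [SetLike.mem_coe, Sylow.coe_subgroup_smul, mem_pointwise_smul_iff_inv_smul_mem] at *
  have := mem_centralizer_iff.1 (h ha) _ hb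
  rw [← smul_mul', ← smul_mul'] at this
  exact smul_left_cancel _ this

theorem sq_le_cent {U : Subgroup G} (hU : Nat.card U = 53 ^ 2) : U ≤ centralizer (U : Set G) := by
  intro a ha
  rw [mem_centralizer_iff]
  intro b hb
  have := IsPGroup.isMulCommutative_of_card_eq_prime_sq hU
  exact congrArg Subtype.val (mul_comm' (⟨b, hb⟩ : U) ⟨a, ha⟩)

/-- The center of `P`, as a subgroup of `G`. -/
def zz (P : Subgroup G) : Subgroup G := P ⊓ centralizer (P : Set G)

theorem two_nonab (H : Hyp G) {U : Subgroup G} (hU : Nat.card U = 53 ^ 2) {P P' : Sylow 53 G}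
    (hne : P ≠ P') (h : U ≤ P) (h' : U ≤ P') : ¬ (P : Subgroup G) ≤ centralizer (U : Set G) := by
  intro hc
  have h1 := ab_of hU (cardP H P) h hc
  have h2 := ab_conj P P' h1
  refine hne (lemB (good_cent H U (by rw [hU]; norm_num)) P P' hc (h2.trans ?_))
  exact centralizer_le h'

theorem nonab (H : Hyp G) {U : Subgroup G} (hU : Nat.card U = 53 ^ 2) {P P' : Sylow 53 G}
    (hne : P ≠ P') (h : U ≤ P) (h' : U ≤ P') (P1 : Sylow 53 G) :
    ¬ (P1 : Subgroup G) ≤ centralizer ((P1 : Subgroup G) : Set G) := by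
  intro hc
  refine two_nonab H hU hne h h' ?_
  exact (ab_conj P1 P hc).trans (centralizer_le h)

theorem zz_props (H : Hyp G) {U : Subgroup G} (hU : Nat.card U = 53 ^ 2) {P : Sylow 53 G}
    (h : U ≤ P) (hc : ¬ (P : Subgroup G) ≤ centralizer ((P : Subgroup G) : Set G)) :
    zz (P : Subgroup G) ≤ U ∧ Nat.card (zz (P : Subgroup G)) = 53 := by
  have hc2 : ¬ (P : Subgroup G) ≤ centralizer (U : Set G) := fun hx =>
    hc (ab_of hU (cardP H P) h hx)
  have h1 : (P : Subgroup G) ⊓ centralizer (U : Set G) = U := by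
    rcases grow hU (cardP H P) (le_inf h (sq_le_cent hU)) inf_le_left with h1 | h1
    · exact h1
    · exact absurd (inf_eq_left.1 h1) hc2
  have h2 : zz (P : Subgroup G) ≤ U := by
    rw [← h1]
    exact inf_le_inf_left _ (centralizer_le h)
  refine ⟨h2, ?_⟩
  obtain ⟨i, hi, hi2⟩ := (Nat.dvd_prime_pow fact53.out).1 (hU ▸ card_dvd_of_le h2)
  have h3 := fp_conj (P : Subgroup G) (P : Subgroup G) P.2 le_normalizer
  change _ ≡ Nat.card (zz (P : Subgroup G)) [MOD 53] at h3
  rw [cardP H, hi2] at h3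
  interval_cases i
  · exact absurd h3 (by decide)
  · rw [hi2, pow_one]
  · exfalso
    have h4 : zz (P : Subgroup G) = U := eq_of_le_of_card_ge h2 (by rw [hi2, hU])
    apply hc2
    intro a ha
    rw [mem_centralizer_iff]
    intro b hb
    rw [← h4] at hb
    exact (mem_centralizer_iff.1 hb.2 a ha).symm

theorem zz_inj (H : Hyp G) {P P' : Sylow 53 G} (hZ : 53 ∣ Nat.card (zz (P : Subgroup G)))
    (h : zz (P : Subgroup G) = zz (P' : Subgroup G)) : P = P' := by
  refine lemB (good_cent H _ hZ) P P' ?_ ?_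
  · intro a ha
    rw [mem_centralizer_iff]
    intro b hb
    exact (mem_centralizer_iff.1 hb.2 a ha).symm
  · rw [h]
    intro a ha
    rw [mem_centralizer_iff]
    intro b hb
    exact (mem_centralizer_iff.1 hb.2 a ha).symm

theorem count_disj (S : Set (Subgroup G)) (Z P : Subgroup G) (n : ℕ)
    (h1 : ∀ U ∈ S, Nat.card U = n) (hP : ∀ U ∈ S, U ≤ P) (hZP : Z ≤ P) (hZ : ∀ U ∈ S, Z ≤ U)
    (h2 : ∀ U ∈ S, ∀ V ∈ S, U ≠ V → U ⊓ V ≤ Z) :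
    S.ncard * (n - Nat.card Z) ≤ Nat.card P - Nat.card Z := by
  classical
  have : Fintype G := Fintype.ofFinite G
  have hSf : S.Finite := Set.toFinite S
  let f : Subgroup G → Finset G := fun U => ((U : Set G) \ Z).toFinset
  have hcard : ∀ U : Subgroup G, Z ≤ U → (f U).card = Nat.card U - Nat.card Z := by
    intro U hU
    rw [← Set.ncard_eq_toFinset_card', Set.ncard_sdiff hU]
    rfl
  have h3 : (hSf.toFinset.biUnion f).card = ∑ U ∈ hSf.toFinset, (f U).card := by
    apply Finset.card_biUnion
    intro U hU V hV hUV
    rw [Finset.mem_coe, Set.Finite.mem_toFinset] at hU hV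
    show Disjoint (f U) (f V)
    rw [Finset.disjoint_left]
    intro a ha hb
    rw [Set.mem_toFinset] at ha hb
    exact ha.2 (h2 U hU V hV hUV ⟨ha.1, hb.1⟩)
  have h4 : hSf.toFinset.biUnion f ⊆ f P := by
    intro a ha
    obtain ⟨U, hU, ha⟩ := Finset.mem_biUnion.1 ha
    rw [Set.Finite.mem_toFinset] at hU
    rw [Set.mem_toFinset] at ha ⊢
    exact ⟨hP U hU ha.1, ha.2⟩
  have h5 := Finset.card_le_card h4
  rw [h3, hcard P hZP] at h5
  rw [Finset.sum_congr rfl (g := fun _ => n - Nat.card Z)] at h5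
  · rw [Finset.sum_const, smul_eq_mul, ← Set.ncard_eq_toFinset_card S hSf] at h5
    exact h5
  · intro U hU
    rw [Set.Finite.mem_toFinset] at hU
    rw [hcard U (hZ U hU), h1 U hU]

theorem inf_prime {U V : Subgroup G} (hU : Nat.card U = 53) (hV : Nat.card V = 53) (h : U ≠ V) :
    U ⊓ V = ⊥ := by
  have h1 : Nat.card (U ⊓ V : Subgroup G) ∣ 53 := hU ▸ card_dvd_of_le inf_le_left
  rcases (Nat.dvd_prime fact53.out).1 h1 with h2 | h2
  · exact card_eq_one.1 h2
  · exfalso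
    apply h
    have a1 : U ⊓ V = U := eq_of_le_of_card_ge inf_le_left (by rw [h2, hU])
    have a2 : U ⊓ V = V := eq_of_le_of_card_ge inf_le_right (by rw [h2, hV])
    rw [← a1, a2]

theorem norm_of_sq {U P : Subgroup G} (hU : Nat.card U = 53 ^ 2) (hP : Nat.card P = 53 ^ 3)
    (h : U ≤ P) : P ≤ normalizer (U : Set G) := by
  have h1 : Nat.card (U.subgroupOf P) = 53 ^ 2 := by
    rw [← hU]; exact Nat.card_congr (subgroupOfEquivOfLe h).toEquiv
  have h2 := Sylow.prime_pow_dvd_card_normalizer (p := 53) (n := 2) (by rw [hP]) h1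
  have h3 : normalizer (U.subgroupOf P : Set P) = ⊤ := by
    rw [← card_eq_iff_eq_top]
    apply Nat.dvd_antisymm (card_subgroup_dvd_card _)
    rw [hP]; exact h2
  have := normalizer_eq_top_iff.1 h3
  exact (normal_subgroupOf_iff_le_normalizer h).1 this

theorem mem_smul_sylow {U : Subgroup G} {P : Sylow 53 G} {g : G} (hg : g ∈ normalizer (U : Set G))
    (h : U ≤ P) : U ≤ (g • P : Sylow 53 G) := by
  intro a ha
  rw [Sylow.coe_subgroup_smul, mem_pointwise_smul_iff_inv_smul_mem]
  apply h
  rw [← map_inv]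
  exact (mem_normalizer_iff.1 (inv_mem hg) a).1 ha

theorem PU_mod (H : Hyp G) {U : Subgroup G} (hU : Nat.card U = 53 ^ 2) {P : Sylow 53 G}
    (h : U ≤ P) : {A : Sylow 53 G | U ≤ A}.ncard ≡ 1 [MOD 53] := by
  have h1 := pfix_set (H := P) 53 P.2 {A : Sylow 53 G | U ≤ A} (by
    intro g A hA
    exact mem_smul_sylow (norm_of_sq hU (cardP H P) h g.2) hA)
  refine h1.trans (OD.Eq.congr_mod ?_ 53)
  rw [Set.ncard_eq_one]
  refine ⟨P, ?_⟩
  ext A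
  constructor
  · rintro ⟨-, h2⟩
    have h3 : (P : Subgroup G) ≤ normalizer ((A : Subgroup G) : Set G) := by
      intro a ha
      exact Sylow.smul_eq_iff_mem_normalizer.1 (h2 ⟨a, ha⟩)
    have h4 : (P : Subgroup G) ⊓ normalizer ((A : Subgroup G) : Set G) = (P : Subgroup G) ⊓ A :=
      P.2.inf_normalizer_sylow A
    rw [inf_eq_left.2 h3] at h4
    exact Sylow.ext (eq_of_le_of_card_ge (inf_eq_left.1 h4.symm) (by
      rw [cardP H A, cardP H P])).symm
  · rintro rfl
    exact ⟨h, fun g => Sylow.smul_eq_iff_mem_normalizer.2 (le_normalizer g.2)⟩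

theorem PU_card (H : Hyp G) {U : Subgroup G} (hU : Nat.card U = 53 ^ 2) {P P' : Sylow 53 G}
    (hne : P ≠ P') (h : U ≤ P) (h' : U ≤ P') : {A : Sylow 53 G | U ≤ A}.ncard = 54 := by
  have hna := nonab H hU hne h h'
  have h1 := PU_mod H hU h
  have h2 : 1 < {A : Sylow 53 G | U ≤ A}.ncard := by
    rw [Set.one_lt_ncard]
    exact ⟨P, h, P', h', hne⟩
  have hzc : ∀ A : Sylow 53 G, U ≤ A → zz (A : Subgroup G) ≤ U ∧ Nat.card (zz (A : Subgroup G)) = 53 :=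
    fun A hA => zz_props H hU hA (hna A)
  have h3 := count_disj ((fun A : Sylow 53 G => zz (A : Subgroup G)) '' {A : Sylow 53 G | U ≤ A}) ⊥ U 53
    ?_ ?_ bot_le ?_ ?_
  · rw [Set.InjOn.ncard_image, card_bot, hU] at h3
    · have h4 : {A : Sylow 53 G | U ≤ A}.ncard ≤ 54 := by omega
      rw [Nat.ModEq] at h1
      omega
    · intro A hA B hB hAB
      exact zz_inj H (by rw [(hzc A hA).2]) hAB
  · rintro _ ⟨A, hA, rfl⟩
    exact (hzc A hA).2
  · rintro _ ⟨A, hA, rfl⟩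
    exact (hzc A hA).1
  · intros; exact bot_le
  · rintro _ ⟨A, hA, rfl⟩ _ ⟨B, hB, rfl⟩ hAB
    exact (inf_prime (hzc A hA).2 (hzc B hB).2 hAB).le

theorem PU_card' (H : Hyp G) {U : Subgroup G} (hU : Nat.card U = 53 ^ 2) :
    {A : Sylow 53 G | U ≤ A}.ncard = 1 ∨ {A : Sylow 53 G | U ≤ A}.ncard = 54 := by
  obtain ⟨P, hP⟩ := (IsPGroup.of_card hU).exists_le_sylow
  by_cases h : ∃ P' : Sylow 53 G, P ≠ P' ∧ U ≤ P'
  · obtain ⟨P', h1, h2⟩ := h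
    exact Or.inr (PU_card H hU h1 hP h2)
  · left
    push Not at h
    rw [Set.ncard_eq_one]
    refine ⟨P, ?_⟩
    ext A
    constructor
    · intro hA
      by_contra hne
      exact h A (fun h => hne h.symm) hA
    · rintro rfl
      exact hP

end
end OD

end

section
open Subgroup MulAction
open scoped Pointwise

namespace OD

section
set_option linter.unusedSectionVars false
variable {G : Type*} [Group G] [Finite G]

theorem thirteen_norm (H : Hyp G) :
    ∃ P : Sylow 53 G, 13 ∣ Nat.card (normalizer ((P : Subgroup G) : Set G)) := by
  obtain ⟨x, y, hx, hy, hxy⟩ := H.adj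
  have hcY : Nat.card (zpowers y) = 53 := by rw [Nat.card_zpowers, hy]
  have hgood := good_norm H (zpowers y) hcY
  have hss := lemA _ hgood
  set N := normalizer ((zpowers y : Subgroup G) : Set G) with hN
  have S : Sylow 53 N := default
  have hNW := le_normalizer_sylow N S
  set W := (S : Subgroup N).map N.subtype with hW
  have hxN : x ∈ N := by
    apply centralizer_le_normalizer
    rw [mem_centralizer_iff]
    rintro z ⟨k, rfl⟩
    have : Commute x (y ^ k) := Commute.zpow_right hxy k
    exact this.symm
  have hWc : Nat.card W = Nat.card S :=
    (Nat.card_congr ((S : Subgroup N).equivMapOfInjective N.subtype (subtype_injective _)).toEquiv).symm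
  have h1 : 53 ^ 2 ∣ Nat.card N := Sylow.prime_pow_dvd_card_normalizer (n := 1)
    (by rw [H.card]; norm_num) (by rw [hcY, pow_one])
  have h2 : 53 ^ 2 ∣ Nat.card W := by
    rw [hWc]; exact S.pow_dvd_card_of_pow_dvd_card h1
  have hWp : IsPGroup 53 W := S.2.map _
  have h3 : Nat.card W ∣ 53 ^ 3 := by
    obtain ⟨P, hP⟩ := hWp.exists_le_sylow
    rw [← cardP H P]
    exact card_dvd_of_le hP
  obtain ⟨i, hi, hi2⟩ := (Nat.dvd_prime_pow fact53.out).1 h3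
  rw [hi2] at h2
  have h4 := (Nat.pow_dvd_pow_iff_le_right (x := 53) (by norm_num)).1 h2
  have hfin : ∀ P : Sylow 53 G, x ∈ normalizer ((P : Subgroup G) : Set G) →
      13 ∣ Nat.card (normalizer ((P : Subgroup G) : Set G)) := by
    intro P hP
    have := card_dvd_of_le ((zpowers_le).2 hP)
    rwa [Nat.card_zpowers, hx] at this
  have : i = 2 ∨ i = 3 := by omega
  rcases this with rfl | rfl
  · have hz : IsPGroup 13 (zpowers x) :=
      IsPGroup.of_card (n := 1) (by rw [Nat.card_zpowers, hx, pow_one])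
    have h5 := pfix_set (H := zpowers x) 13 hz {A : Sylow 53 G | W ≤ A} (by
      intro g A hA
      exact mem_smul_sylow (hNW ((zpowers_le.2 hxN) g.2)) hA)
    have h6 : {a ∈ {A : Sylow 53 G | W ≤ A} | ∀ h : zpowers x, h • a = a}.Nonempty := by
      rw [Set.nonempty_iff_ne_empty]
      intro h0
      rw [h0, Set.ncard_empty] at h5
      rcases PU_card' H hi2 with h7 | h7 <;> rw [h7] at h5 <;> exact absurd h5 (by decide)
    obtain ⟨P, -, hP⟩ := h6
    exact ⟨P, hfin P (Sylow.smul_eq_iff_mem_normalizer.1 (hP ⟨x, mem_zpowers x⟩))⟩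
  · obtain ⟨P, hP⟩ := sylow_of_card H W hi2
    refine ⟨P, hfin P ?_⟩
    rw [hP]
    exact hNW hxN

theorem arith_m (n m : ℕ) (h : n * m = 2 ^ 5 * 3 ^ 3 * 7 * 13 ^ 2 * 409) (hn : n % 53 = 1)
    (h13 : 13 ∣ m) (h3 : ¬ 3 ∣ m) : n = 54 ∨ n = 154602 := by
  have hm : m % 53 = 1 := by
    have := congrArg (· % 53) h
    simp only [Nat.mul_mod n, hn] at this
    norm_num at this
    omega
  have h1 : m ∣ (2 ^ 5 * 7) * (13 ^ 2 * 409) := by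
    refine Nat.Coprime.dvd_of_dvd_mul_left (m := 3 ^ 3) ?_ ⟨n, by rw [mul_comm m, h]; norm_num⟩
    exact (((Nat.Prime.coprime_iff_not_dvd (by norm_num)).2 h3).symm).pow_right 3
  obtain ⟨a, b, ha, hb, rfl⟩ := (Nat.dvd_mul).1 h1
  obtain ⟨a1, a2, ha1, ha2, rfl⟩ := (Nat.dvd_mul).1 ha
  obtain ⟨b1, b2, hb1, hb2, rfl⟩ := (Nat.dvd_mul).1 hb
  obtain ⟨i, hi, rfl⟩ := (Nat.dvd_prime_pow Nat.prime_two).1 ha1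
  obtain ⟨j, hj, rfl⟩ := (Nat.dvd_prime_pow fact13.out).1 hb1
  rcases (Nat.dvd_prime fact7.out).1 ha2 with rfl | rfl <;>
  rcases (Nat.dvd_prime fact409.out).1 hb2 with rfl | rfl <;>
  interval_cases i <;> interval_cases j <;> omega

theorem ker_le_norm (P : Sylow 53 G) :
    (toPermHom G (Sylow 53 G)).ker ≤ normalizer ((P : Subgroup G) : Set G) := by
  intro g hg
  rw [MonoidHom.mem_ker] at hg
  have := congrArg (fun f : Equiv.Perm (Sylow 53 G) => f P) hg
  exact Sylow.smul_eq_iff_mem_normalizer.1 this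

theorem not409_of_not3 (H : Hyp G) (K : Subgroup G) [K.Normal] (h3 : ¬ 3 ∣ Nat.card K) :
    ¬ 409 ∣ Nat.card K := by
  intro h
  have h1 := frattini H K h
  have h2 := card_mul_index K
  rw [H.card] at h2
  obtain ⟨k, hk⟩ := h1
  have h4 : 3 ^ 2 ∣ K.index := by
    refine Nat.Coprime.dvd_of_dvd_mul_left (m := Nat.card K) ?_ ?_
    · exact ((Nat.Prime.coprime_iff_not_dvd (by norm_num)).2 h3).pow_left 2
    · rw [h2]; norm_num
  have h5 : 3 ^ 2 ∣ 8589 := h4.trans ⟨k, hk⟩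
  norm_num at h5

theorem card_sylow53 (H : Hyp G) : Nat.card (Sylow 53 G) = 154602 := by
  obtain ⟨P, h13⟩ := thirteen_norm H
  have h3 := three_not_norm H P
  have h1 := card_np H P
  obtain ⟨m, hm⟩ := card_dvd_of_le (le_normalizer (H := (P : Subgroup G)))
  rw [cardP H] at hm
  rw [hm] at h1 h13 h3
  have h2 : Nat.card (Sylow 53 G) * m = 2 ^ 5 * 3 ^ 3 * 7 * 13 ^ 2 * 409 := by
    have : 53 ^ 3 * (Nat.card (Sylow 53 G) * m) = 53 ^ 3 * (2 ^ 5 * 3 ^ 3 * 7 * 13 ^ 2 * 409) := by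
      linarith
    exact Nat.eq_of_mul_eq_mul_left (by norm_num) this
  have h13m : 13 ∣ m := Nat.Coprime.dvd_of_dvd_mul_left (by norm_num) h13
  rcases arith_m _ m h2 (card_sylow_mod 53) h13m (fun h => h3 (h.mul_left _)) with h4 | h4
  · exfalso
    let K := (toPermHom G (Sylow 53 G)).ker
    have hK3 : ¬ 3 ∣ Nat.card K := fun h => three_not_norm H P (h.trans (card_dvd_of_le (ker_le_norm P)))
    apply not409_of_not3 H K hK3
    obtain ⟨q, hq⟩ := exists_prime_orderOf_dvd_card' (G := G) 409 (by rw [H.card]; norm_num)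
    have hqK : q ∈ K := by
      rw [MonoidHom.mem_ker, ← orderOf_eq_one_iff]
      have h5 : orderOf (toPermHom G (Sylow 53 G) q) ∣ 409 := hq ▸ orderOf_map_dvd _ q
      rcases (Nat.dvd_prime fact409.out).1 h5 with h6 | h6
      · exact h6
      · exfalso
        have h7 := orderOf_dvd_natCard (toPermHom G (Sylow 53 G) q)
        rw [h6, Nat.card_perm, h4, Nat.Prime.dvd_factorial fact409.out] at h7
        omega
    have := card_dvd_of_le (zpowers_le.2 hqK)
    rwa [Nat.card_zpowers, hq] at this
  · exact h4

end
end OD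

end

section
open Subgroup MulAction
open scoped Pointwise

namespace OD

/-- Counting through the fibres of a map. -/
theorem fiber_count {α β : Type*} [Finite α] [Finite β] (f : α → β) (s : Set α) (t : Set β) (n : ℕ)
    (hf : ∀ a ∈ s, f a ∈ t) (h : ∀ b ∈ t, {a ∈ s | f a = b}.ncard = n) :
    s.ncard = t.ncard * n := by
  classical
  have : Fintype α := Fintype.ofFinite α
  have : Fintype β := Fintype.ofFinite β
  have h1 := Finset.card_eq_sum_card_fiberwise (f := f) (s := s.toFinset) (t := t.toFinset)
    (by intro a ha; simpa using hf a (by simpa using ha))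
  rw [← Set.ncard_eq_toFinset_card'] at h1
  rw [h1, Finset.sum_congr rfl (g := fun _ => n), Finset.sum_const, smul_eq_mul,
    ← Set.ncard_eq_toFinset_card']
  intro b hb
  rw [← h b (by simpa using hb), Set.ncard_eq_toFinset_card']
  congr 1
  ext a
  simp

section
set_option linter.unusedSectionVars false
variable {G : Type*} [Group G] [Finite G]

/-- vertices: subgroups of order `53 ^ 2` in at least two Sylow subgroups. -/
def IsV (U : Subgroup G) : Prop :=
  Nat.card U = 53 ^ 2 ∧ ∃ P P' : Sylow 53 G, P ≠ P' ∧ U ≤ P ∧ U ≤ P'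

theorem IsV.nonab (H : Hyp G) {U : Subgroup G} (hU : IsV U) (P1 : Sylow 53 G) :
    ¬ (P1 : Subgroup G) ≤ centralizer ((P1 : Subgroup G) : Set G) := by
  obtain ⟨h, P, P', h1, h2, h3⟩ := hU
  exact OD.nonab H h h1 h2 h3 P1

theorem IsV.PU (H : Hyp G) {U : Subgroup G} (hU : IsV U) :
    {A : Sylow 53 G | U ≤ A}.ncard = 54 := by
  obtain ⟨h, P, P', h1, h2, h3⟩ := hU
  exact PU_card H h h1 h2 h3

theorem inf_eq_of_sq (H : Hyp G) {U : Subgroup G} (hU : Nat.card U = 53 ^ 2) {P A : Sylow 53 G}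
    (hne : P ≠ A) (h1 : U ≤ P) (h2 : U ≤ A) : (P : Subgroup G) ⊓ A = U := by
  rcases grow hU (cardP H P) (le_inf h1 h2) inf_le_left with h | h
  · exact h
  · exfalso
    apply hne
    exact Sylow.ext (eq_of_le_of_card_ge (inf_eq_left.1 h) (by rw [cardP H P, cardP H A]))

theorem IsV.zz (H : Hyp G) {U : Subgroup G} (hU : IsV U) {P : Sylow 53 G} (h : U ≤ P) :
    zz (P : Subgroup G) ≤ U ∧ Nat.card (OD.zz (P : Subgroup G)) = 53 :=
  zz_props H hU.1 h (hU.nonab H P)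

theorem sq_inf_zz (H : Hyp G) {U V : Subgroup G} (hU : IsV U) (hV : IsV V) {P : Sylow 53 G}
    (h : U ≤ P) (h' : V ≤ P) (hne : U ≠ V) : U ⊓ V = zz (P : Subgroup G) := by
  obtain ⟨h1, h2⟩ := hU.zz H h
  obtain ⟨h3, -⟩ := hV.zz H h'
  have hc := card_dvd_of_le (inf_le_left (a := U) (b := V))
  rw [hU.1] at hc
  obtain ⟨i, hi, hi2⟩ := (Nat.dvd_prime_pow fact53.out).1 hc
  symm
  apply eq_of_le_of_card_ge (le_inf h1 h3)
  rw [h2, hi2]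
  interval_cases i
  · norm_num
  · norm_num
  · exfalso
    apply hne
    have a1 : U ⊓ V = U := eq_of_le_of_card_ge inf_le_left (by rw [hi2, hU.1])
    have a2 : U ⊓ V = V := eq_of_le_of_card_ge inf_le_right (by rw [hi2, hV.1])
    rw [← a1, a2]

theorem VP_le (H : Hyp G) (P : Sylow 53 G) : {U : Subgroup G | IsV U ∧ U ≤ P}.ncard ≤ 54 := by
  by_cases hne : {U : Subgroup G | IsV U ∧ U ≤ P}.Nonempty
  · obtain ⟨U0, hU0, hUP0⟩ := hne
    obtain ⟨-, hz⟩ := hU0.zz H hUP0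
    have h := count_disj {U : Subgroup G | IsV U ∧ U ≤ P} (zz (P : Subgroup G)) P (53 ^ 2)
      (fun U hU => hU.1.1) (fun U hU => hU.2) inf_le_left (fun U hU => (hU.1.zz H hU.2).1)
      (fun U hU V hV hUV => (sq_inf_zz H hU.1 hV.1 hU.2 hV.2 hUV).le)
    rw [hz, cardP H P] at h
    omega
  · rw [Set.not_nonempty_iff_eq_empty.1 hne, Set.ncard_empty]; norm_num

theorem smul_self_sylow (P : Sylow 53 G) (g : P) : g • P = P :=
  Sylow.smul_eq_iff_mem_normalizer.2 (le_normalizer g.2)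

theorem VP_card (H : Hyp G) (P : Sylow 53 G) : {U : Subgroup G | IsV U ∧ U ≤ P}.ncard = 2 := by
  have hle := VP_le H P
  set a := {U : Subgroup G | IsV U ∧ U ≤ P}.ncard with ha
  let S1 : Set (Sylow 53 G) := {A | A ≠ P ∧ Nat.card ((P : Subgroup G) ⊓ A : Subgroup G) = 53 ^ 2}
  let S2 : Set (Sylow 53 G) := {A | A ≠ P ∧ Nat.card ((P : Subgroup G) ⊓ A : Subgroup G) ≠ 53 ^ 2}
  have h1 : S1.ncard = a * 53 := by
    refine fiber_count (fun A : Sylow 53 G => (P : Subgroup G) ⊓ A) S1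
      {U : Subgroup G | IsV U ∧ U ≤ P} 53 ?_ ?_
    · rintro A ⟨h1, h2⟩
      exact ⟨⟨h2, A, P, h1, inf_le_right, inf_le_left⟩, inf_le_left⟩
    · rintro U ⟨h1, h2⟩
      have h3 := h1.PU H
      have h4 : {A ∈ S1 | (P : Subgroup G) ⊓ A = U} = {A : Sylow 53 G | U ≤ A} \ {P} := by
        ext A
        constructor
        · rintro ⟨h4, h5⟩
          refine ⟨?_, h4.1⟩
          show U ≤ A
          rw [← h5]
          exact inf_le_right
        · rintro ⟨h4, h5⟩
          have h6 := inf_eq_of_sq H h1.1 (fun h => h5 h.symm) h2 h4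
          exact ⟨⟨h5, by rw [h6, h1.1]⟩, h6⟩
      rw [h4, Set.ncard_sdiff_singleton_of_mem h2, h3]
  have h2 : 53 ^ 2 ∣ S2.ncard := by
    apply orb_dvd_set (H := P)
    · rintro g A ⟨h3, h4⟩
      refine ⟨fun h => h3 ?_, ?_⟩
      · rw [← inv_smul_smul g A, h]; exact smul_self_sylow P g⁻¹
      · have h5 : (P : Subgroup G) ⊓ (g • A : Sylow 53 G) = MulAut.conj (g : G) • ((P : Subgroup G) ⊓ A) := by
          rw [smul_inf]
          congr 1
          exact (congrArg (fun B : Sylow 53 G => (B : Subgroup G)) (smul_self_sylow P g)).symm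
        rw [h5, ← Nat.card_congr (equivSMul (MulAut.conj (g : G)) ((P : Subgroup G) ⊓ A)).toEquiv]
        exact h4
    · rintro A ⟨h3, h4⟩
      have h5 := sylow_orbit P A
      rw [cardP H P] at h5
      obtain ⟨i, hi, hi2⟩ := (Nat.dvd_prime_pow fact53.out).1 (cardP H P ▸ card_dvd_of_le (inf_le_left (a := (P : Subgroup G)) (b := A)))
      rw [hi2] at h5 h4
      interval_cases i
      · exact ⟨53, by omega⟩
      · exact ⟨1, by omega⟩
      · exact absurd rfl h4
      · exfalso
        apply h3
        have : (P : Subgroup G) ⊓ A = P := eq_of_le_of_card_ge inf_le_left (by rw [hi2, cardP H P])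
        exact (Sylow.ext (eq_of_le_of_card_ge (inf_eq_left.1 this) (by rw [cardP H P, cardP H A]))).symm
  have h3 : Nat.card (Sylow 53 G) = 1 + S1.ncard + S2.ncard := by
    have e1 : S1 ∪ S2 = {P}ᶜ := by
      ext A
      simp only [S1, S2, Set.mem_union, Set.mem_ofPred_eq, Set.mem_compl_iff, Set.mem_singleton_iff]
      tauto
    have e2 : Disjoint S1 S2 := by
      rw [Set.disjoint_left]
      rintro A h1 h2
      exact h2.2 h1.2
    have e3 := Set.ncard_union_eq e2
    rw [e1, Set.ncard_compl, Set.ncard_singleton] at e3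
    have : 0 < Nat.card (Sylow 53 G) := Nat.card_pos
    omega
  rw [card_sylow53 H, h1] at h3
  omega

/-- the other vertex -/
theorem VP_eq (H : Hyp G) {P : Sylow 53 G} {U V W : Subgroup G} (hU : IsV U) (hV : IsV V)
    (hW : IsV W) (h1 : U ≤ P) (h2 : V ≤ P) (h3 : W ≤ P) (hUV : U ≠ V) (hUW : U ≠ W) : V = W := by
  have h := VP_card H P
  by_contra hVW
  have : 2 < {U : Subgroup G | IsV U ∧ U ≤ P}.ncard := by
    rw [Set.two_lt_ncard]
    exact ⟨U, ⟨hU, h1⟩, V, ⟨hV, h2⟩, W, ⟨hW, h3⟩, hUV, hUW, hVW⟩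
  omega

theorem VP_other (H : Hyp G) (P : Sylow 53 G) (U : Subgroup G) :
    ∃ V, IsV V ∧ V ≤ P ∧ U ≠ V := by
  have h := VP_card H P
  obtain ⟨X, Y, hXY, h2⟩ := Set.ncard_eq_two.1 h
  have hX : X ∈ {U : Subgroup G | IsV U ∧ U ≤ P} := by rw [h2]; simp
  have hY : Y ∈ {U : Subgroup G | IsV U ∧ U ≤ P} := by rw [h2]; simp
  by_cases hUX : U = X
  · exact ⟨Y, hY.1, hY.2, by rw [hUX]; exact hXY⟩
  · exact ⟨X, hX.1, hX.2, hUX⟩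

/-- uniqueness of the Sylow subgroup containing two vertices -/
theorem edge_sylow (H : Hyp G) {P A : Sylow 53 G} {U V : Subgroup G} (hU : IsV U) (hV : IsV V)
    (hUV : U ≠ V) (h1 : U ≤ P) (h2 : V ≤ P) (h3 : U ≤ A) (h4 : V ≤ A) : P = A := by
  by_contra hne
  have a1 := inf_eq_of_sq H hU.1 hne h1 h3
  have a2 := inf_eq_of_sq H hV.1 hne h2 h4
  exact hUV (a1.symm.trans a2)

theorem V_card (H : Hyp G) : {U : Subgroup G | IsV U}.ncard = 5726 := by
  let S : Set (Subgroup G × Sylow 53 G) := {x | IsV x.1 ∧ x.1 ≤ x.2}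
  have h1 : S.ncard = {U : Subgroup G | IsV U}.ncard * 54 := by
    refine fiber_count Prod.fst S _ 54 (fun a ha => ha.1) ?_
    intro U hU
    rw [← hU.PU H]
    refine (Set.ncard_congr (fun A _ => (U, A)) ?_ ?_ ?_).symm
    · intro A hA
      exact ⟨⟨hU, hA⟩, rfl⟩
    · intro A B _ _ h
      exact congrArg Prod.snd h
    · rintro ⟨X, A⟩ ⟨⟨h2, h3⟩, h4⟩
      simp only at h4
      subst h4
      exact ⟨A, h3, rfl⟩
  have h2 : S.ncard = (Set.univ : Set (Sylow 53 G)).ncard * 2 := by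
    refine fiber_count Prod.snd S _ 2 (fun a ha => Set.mem_univ _) ?_
    intro A _
    rw [← VP_card H A]
    refine (Set.ncard_congr (fun U _ => (U, A)) ?_ ?_ ?_).symm
    · intro U hU
      exact ⟨hU, rfl⟩
    · intro U V _ _ h
      exact congrArg Prod.fst h
    · rintro ⟨X, B⟩ ⟨h3, h4⟩
      simp only at h4
      subst h4
      exact ⟨X, h3, rfl⟩
  rw [Set.ncard_univ, card_sylow53 H] at h2
  omega

end
end OD

end

section
open Subgroup MulAction
open scoped Pointwise

namespace OD

/-- The combinatorial data of the graph of vertices. -/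
structure Geo {G Ω : Type*} [Group G] [MulAction G Ω] (adj : Ω → Ω → Prop)
    (E : Ω → Subgroup G) : Prop where
  symm : ∀ {U V}, adj U V → adj V U
  irrefl : ∀ U, ¬ adj U U
  smul : ∀ (g : G) {U V}, adj U V → adj (g • U) (g • V)
  deg : ∀ U, {W | adj U W}.ncard = 54
  fixE : ∀ {U V}, adj U V → ∀ v ∈ E V, v • U = U
  fixV : ∀ V, ∀ v ∈ E V, v • V = V
  trans : ∀ {U V W W'}, adj U V → adj U W → adj U W' → W ≠ V → W' ≠ V → ∃ v ∈ E V, v • W = W'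
  card : Nat.card Ω = 5726
  edge : ∀ {U V U' V'}, adj U V → adj U' V' →
    ∃ g : G, (g • U = U' ∧ g • V = V') ∨ (g • U = V' ∧ g • V = U')
  faithful : ∀ g : G, (∀ U : Ω, g • U = U) → g = 1
  cardE : ∀ V, Nat.card (E V) = 53 ^ 2
  noidx : ∀ L : Subgroup G, L.index ≠ 2
  fixW : ∀ {U V W}, adj U V → adj W U → W ≠ V → ∀ v ∈ E V, v • W = W → v ∈ E U
  inf3 : ∀ {U U' V}, U ≠ U' → adj U V → adj U' V → ∀ v ∈ E U, v ∈ E U' → v ∈ E V → v = 1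
  inf2 : ∀ {U V}, adj U V → Nat.card (E U ⊓ E V : Subgroup G) = 53

section
set_option linter.unusedSectionVars false
variable {G : Type*} [Group G] [Finite G]

theorem conj_smul_eq_iff {U : Subgroup G} {g : G} :
    MulAut.conj g • U = U ↔ g ∈ normalizer (U : Set G) := by
  rw [mem_normalizer_iff]
  constructor
  · intro h x
    have := smul_mem_pointwise_smul_iff (a := MulAut.conj g) (S := U) (x := x)
    rw [h] at this
    exact this.symm
  · intro h
    ext x
    rw [mem_pointwise_smul_iff_inv_smul_mem, h, ← map_inv]
    simp [MulAut.smul_def, mul_assoc]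

theorem IsV.conj {U : Subgroup G} (hU : IsV U) (g : G) : IsV (MulAut.conj g • U) := by
  obtain ⟨h, P, P', h1, h2, h3⟩ := hU
  refine ⟨?_, g • P, g • P', fun h => h1 (smul_left_cancel g h), ?_, ?_⟩
  · rw [← h]
    exact (Nat.card_congr (equivSMul (MulAut.conj g) U).toEquiv).symm
  · rw [Sylow.coe_subgroup_smul]; exact pointwise_smul_le_pointwise_smul_iff.2 h2
  · rw [Sylow.coe_subgroup_smul]; exact pointwise_smul_le_pointwise_smul_iff.2 h3

variable (G) in
/-- The vertex set. -/
def Vx : Type _ := {U : Subgroup G // IsV U}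

instance : Finite (Vx G) := inferInstanceAs (Finite {U : Subgroup G // IsV U})

instance : MulAction G (Vx G) where
  smul g U := ⟨MulAut.conj g • U.1, U.2.conj g⟩
  one_smul U := Subtype.ext (by
    show MulAut.conj (1 : G) • U.1 = U.1
    rw [map_one, one_smul])
  mul_smul g h U := Subtype.ext (by
    show MulAut.conj (g * h) • U.1 = MulAut.conj g • MulAut.conj h • U.1
    rw [map_mul, mul_smul])

theorem Vx.smul_val (g : G) (U : Vx G) : (g • U).1 = MulAut.conj g • U.1 := rfl

theorem Vx.fix_iff {g : G} {U : Vx G} : g • U = U ↔ g ∈ normalizer (U.1 : Set G) := by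
  rw [← conj_smul_eq_iff]
  exact ⟨fun h => congrArg Subtype.val h, fun h => Subtype.ext h⟩

/-- adjacency -/
def vadj (U V : Vx G) : Prop := U ≠ V ∧ ∃ P : Sylow 53 G, U.1 ≤ P ∧ V.1 ≤ P

theorem Vx.ne {U V : Vx G} (h : U ≠ V) : U.1 ≠ V.1 := fun h' => h (Subtype.ext h')

theorem smul_le_sylow {U : Vx G} {P : Sylow 53 G} (g : G) (h : U.1 ≤ P) :
    (g • U).1 ≤ (g • P : Sylow 53 G) := by
  rw [Sylow.coe_subgroup_smul]; exact pointwise_smul_le_pointwise_smul_iff.2 h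

theorem mem_sylow_of_fix (P : Sylow 53 G) (K : Subgroup G) (hK : IsPGroup 53 K) (x : G)
    (hx : x ∈ K) (h : x ∈ normalizer ((P : Subgroup G) : Set G)) : x ∈ (P : Subgroup G) := by
  have h1 : K ⊓ normalizer ((P : Subgroup G) : Set G) = K ⊓ P := hK.inf_normalizer_sylow P
  have h2 : x ∈ K ⊓ normalizer ((P : Subgroup G) : Set G) := mem_inf.2 ⟨hx, h⟩
  rw [h1] at h2
  exact h2.2

theorem orbit_V (H : Hyp G) {U V : Vx G} {P A : Sylow 53 G} (hne : U ≠ V) (hU : U.1 ≤ P)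
    (hV : V.1 ≤ P) (hA : U.1 ≤ A) (hPA : P ≠ A) : Nat.card (orbit V.1 A) = 53 := by
  have h0 := card_mul_index (stabilizer V.1 A)
  rw [index_stabilizer, V.2.1] at h0
  have h1 : stabilizer V.1 A = (U.1 ⊓ V.1).subgroupOf V.1 := by
    ext ⟨t, ht⟩
    simp only [mem_stabilizer_iff, mem_subgroupOf, mem_inf]
    change t • A = A ↔ _
    rw [Sylow.smul_eq_iff_mem_normalizer]
    constructor
    · intro h
      have h2 := mem_sylow_of_fix A V.1 (IsPGroup.of_card V.2.1) t ht h
      refine ⟨?_, ht⟩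
      rw [← inf_eq_of_sq H U.2.1 hPA hU hA]
      exact ⟨hV ht, h2⟩
    · rintro ⟨h, -⟩
      exact le_normalizer (hA h)
  have h2 : Nat.card (stabilizer V.1 A) = 53 := by
    rw [h1, Nat.card_congr (subgroupOfEquivOfLe inf_le_right).toEquiv,
      sq_inf_zz H U.2 V.2 hU hV (Vx.ne hne), (U.2.zz H hU).2]
  rw [h2] at h0
  have h3 : Nat.card (orbit V.1 A) = (orbit V.1 A).ncard := rfl
  omega

theorem vtrans (H : Hyp G) {U V W W' : Vx G} (h1 : vadj U V) (h2 : vadj U W) (h3 : vadj U W')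
    (h4 : W ≠ V) (h5 : W' ≠ V) : ∃ v ∈ V.1, v • W = W' := by
  obtain ⟨hUV, P, hUP, hVP⟩ := h1
  obtain ⟨hUW, A, hUA, hWA⟩ := h2
  obtain ⟨hUW', A', hUA', hWA'⟩ := h3
  have hPA : P ≠ A := by
    rintro rfl
    exact Vx.ne h4 (VP_eq H U.2 W.2 V.2 hUP hWA hVP (Vx.ne hUW) (Vx.ne hUV))
  have hPA' : P ≠ A' := by
    rintro rfl
    exact Vx.ne h5 (VP_eq H U.2 W'.2 V.2 hUP hWA' hVP (Vx.ne hUW') (Vx.ne hUV))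
  have hor := orbit_V H hUV hUP hVP hUA hPA
  have hVU : V.1 ≤ normalizer (U.1 : Set G) := hVP.trans (norm_of_sq U.2.1 (cardP H P) hUP)
  have hsub : orbit V.1 A ⊆ {B : Sylow 53 G | U.1 ≤ B} \ {P} := by
    rintro _ ⟨v, rfl⟩
    refine ⟨mem_smul_sylow (hVU v.2) hUA, ?_⟩
    intro h
    apply hPA
    have h' : v • A = P := h
    rw [← inv_smul_smul v A, h']
    exact (Sylow.smul_eq_iff_mem_normalizer.2 (le_normalizer (hVP (v⁻¹).2))).symm
  have heq : orbit V.1 A = {B : Sylow 53 G | U.1 ≤ B} \ {P} := by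
    apply Set.eq_of_subset_of_ncard_le hsub
    rw [Set.ncard_sdiff_singleton_of_mem (show P ∈ {B : Sylow 53 G | U.1 ≤ B} from hUP), U.2.PU H]
    exact hor.ge
  have hmem : A' ∈ orbit V.1 A := by
    rw [heq]; exact ⟨hUA', fun h => hPA' h.symm⟩
  obtain ⟨v, hv⟩ := hmem
  have hv' : (v : G) • A = A' := hv
  refine ⟨v, v.2, Subtype.ext ?_⟩
  have hfix : (v : G) • U = U := Vx.fix_iff.2 (hVU v.2)
  have hne : U ≠ (v : G) • W := by
    intro h
    rw [← hfix] at h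
    exact hUW (smul_left_cancel _ h)
  have hle : ((v : G) • W).1 ≤ A' := by rw [← hv']; exact smul_le_sylow _ hWA
  exact VP_eq H U.2 ((v : G) • W).2 W'.2 hUA' hle hWA' (Vx.ne hne) (Vx.ne hUW')

theorem vdeg (H : Hyp G) (U : Vx G) : {W | vadj U W}.ncard = 54 := by
  rw [← U.2.PU H]
  choose f hf1 hf2 hf3 using fun P : Sylow 53 G => VP_other H P U.1
  refine (Set.ncard_congr (fun P _ => (⟨f P, hf1 P⟩ : Vx G)) ?_ ?_ ?_).symm
  · intro P hP
    exact ⟨fun h => hf3 P (congrArg Subtype.val h), P, hP, hf2 P⟩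
  · intro P A hP hA h
    have h' : f P = f A := congrArg Subtype.val h
    refine edge_sylow H U.2 (hf1 P) (hf3 P) hP (hf2 P) hA ?_
    rw [h']; exact hf2 A
  · rintro W ⟨hne, P, hUP, hWP⟩
    refine ⟨P, hUP, Subtype.ext ?_⟩
    exact VP_eq H U.2 (hf1 P) W.2 hUP (hf2 P) hWP (hf3 P) (Vx.ne hne)

theorem vinf3 (H : Hyp G) {U U' V : Vx G} (hne : U ≠ U') (h1 : vadj U V) (h2 : vadj U' V) (v : G)
    (hv1 : v ∈ U.1) (hv2 : v ∈ U'.1) (hv3 : v ∈ V.1) : v = 1 := by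
  obtain ⟨hUV, P, hUP, hVP⟩ := h1
  obtain ⟨hUV', A, hUA, hVA⟩ := h2
  have hPA : P ≠ A := by
    rintro rfl
    exact Vx.ne hne (VP_eq H V.2 U.2 U'.2 hVP hUP hUA (Vx.ne hUV).symm (Vx.ne hUV').symm)
  have e1 := sq_inf_zz H U.2 V.2 hUP hVP (Vx.ne hUV)
  have e2 := sq_inf_zz H U'.2 V.2 hUA hVA (Vx.ne hUV')
  have c1 := (U.2.zz H hUP).2
  have c2 := (U'.2.zz H hUA).2
  have hzne : zz (P : Subgroup G) ≠ zz (A : Subgroup G) := fun h => hPA (zz_inj H (by rw [c1]) h)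
  have := inf_prime c1 c2 hzne
  rw [← e1, ← e2] at this
  have hm : v ∈ U.1 ⊓ V.1 ⊓ (U'.1 ⊓ V.1) := ⟨⟨hv1, hv3⟩, ⟨hv2, hv3⟩⟩
  rw [this] at hm
  exact mem_bot.1 hm

theorem fix_sylow (H : Hyp G) {U V : Vx G} (hne : U ≠ V) {P : Sylow 53 G} (hU : U.1 ≤ P)
    (hV : V.1 ≤ P) {g : G} (h1 : g • U = U) (h2 : g • V = V) :
    g ∈ normalizer ((P : Subgroup G) : Set G) := by
  refine Sylow.smul_eq_iff_mem_normalizer.1 ?_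
  refine edge_sylow H U.2 V.2 (Vx.ne hne) ?_ ?_ hU hV
  · have := smul_le_sylow g hU
    rwa [h1] at this
  · have := smul_le_sylow g hV
    rwa [h2] at this

theorem ex_edge (H : Hyp G) (P : Sylow 53 G) : ∃ U V : Vx G, U ≠ V ∧ U.1 ≤ P ∧ V.1 ≤ P := by
  obtain ⟨U, hU, hUP, -⟩ := VP_other H P ⊥
  obtain ⟨V, hV, hVP, hne⟩ := VP_other H P U
  exact ⟨⟨U, hU⟩, ⟨V, hV⟩, fun h => hne (congrArg Subtype.val h), hUP, hVP⟩

theorem arithK (n : ℕ) (h : n ∣ 2 ^ 5 * 13 ^ 2) (h1 : n % 409 = 1) : n = 1 := by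
  obtain ⟨a, b, ha, hb, rfl⟩ := (Nat.dvd_mul).1 h
  obtain ⟨i, hi, rfl⟩ := (Nat.dvd_prime_pow Nat.prime_two).1 ha
  obtain ⟨j, hj, rfl⟩ := (Nat.dvd_prime_pow fact13.out).1 hb
  interval_cases i <;> interval_cases j <;> simp_all

theorem vfaithful (H : Hyp G) (g : G) (hg : ∀ U : Vx G, g • U = U) : g = 1 := by
  let K := (toPermHom G (Vx G)).ker
  have hKmem : ∀ k, k ∈ K ↔ ∀ U : Vx G, k • U = U := by
    intro k
    rw [MonoidHom.mem_ker]
    exact ⟨fun h U => congrArg (fun f : Equiv.Perm (Vx G) => f U) h, fun h => Equiv.ext h⟩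
  have hKn : K.Normal := inferInstance
  have hKP : ∀ P : Sylow 53 G, K ≤ normalizer ((P : Subgroup G) : Set G) := by
    intro P k hk
    rw [hKmem] at hk
    obtain ⟨U, V, hne, hU, hV⟩ := ex_edge H P
    exact fix_sylow H hne hU hV (hk U) (hk V)
  have P : Sylow 53 G := default
  have h3 : ¬ 3 ∣ Nat.card K := fun h => three_not_norm H P (h.trans (card_dvd_of_le (hKP P)))
  have h409 := not409_of_not3 H K h3
  have h53 : ¬ 53 ∣ Nat.card K := by
    intro h
    obtain ⟨x, hx, hx2⟩ := cauchy_mem 53 _ h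
    have hxP : ∀ P : Sylow 53 G, x ∈ (P : Subgroup G) := fun P =>
      mem_sylow_of_fix P (zpowers x) (IsPGroup.of_card (n := 1) (by rw [Nat.card_zpowers, hx2, pow_one]))
        x (mem_zpowers x) (hKP P hx)
    have hxU : ∀ U : Vx G, x ∈ U.1 := by
      intro U
      obtain ⟨h, P, P', h1, h2, h3⟩ := U.2
      rw [← inf_eq_of_sq H h h1 h2 h3]
      exact ⟨hxP P, hxP P'⟩
    obtain ⟨V, -, -, -, -⟩ := ex_edge H P
    have hd := vdeg H V
    have : 1 < {W | vadj V W}.ncard := by omega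
    rw [Set.one_lt_ncard] at this
    obtain ⟨U, hU, U', hU', hne⟩ := this
    have symm : ∀ {A B : Vx G}, vadj A B → vadj B A := fun h => ⟨h.1.symm, h.2.imp fun _ h => h.symm⟩
    have := vinf3 H hne (symm hU) (symm hU') x (hxU _) (hxU _) (hxU _)
    rw [this, orderOf_one] at hx2
    norm_num at hx2
  have hdisj : K ⊓ P = ⊥ := by
    have h1 := card_dvd_of_le (inf_le_right (a := K) (b := (P : Subgroup G)))
    rw [cardP H] at h1
    obtain ⟨i, hi, hi2⟩ := (Nat.dvd_prime_pow fact53.out).1 h1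
    rcases i with _ | i
    · exact card_eq_one.1 hi2
    · exfalso
      apply h53
      refine dvd_trans ?_ (card_dvd_of_le (inf_le_left (a := K) (b := (P : Subgroup G))))
      rw [hi2]
      exact Dvd.intro_left _ rfl
  have hKC : K ≤ centralizer ((P : Subgroup G) : Set G) := by
    intro k hk
    rw [mem_centralizer_iff]
    intro a ha
    have m1 : k * a * k⁻¹ * a⁻¹ ∈ (P : Subgroup G) :=
      mul_mem ((mem_normalizer_iff.1 (hKP P hk) a).1 ha) (inv_mem ha)
    have m2 : k * a * k⁻¹ * a⁻¹ ∈ K := by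
      have := mul_mem hk (hKn.conj_mem k⁻¹ (inv_mem hk) a)
      rwa [← mul_assoc, ← mul_assoc] at this
    have m3 : k * a * k⁻¹ * a⁻¹ ∈ K ⊓ P := ⟨m2, m1⟩
    rw [hdisj, mem_bot] at m3
    have : k * a = a * k := by
      calc k * a = (k * a * k⁻¹ * a⁻¹) * (a * k) := by group
        _ = a * k := by rw [m3, one_mul]
    exact this.symm
  have hc1 : Nat.card K ∣ 53 ^ 3 * (2 ^ 5 * 13 ^ 2) :=
    (card_dvd_of_le hKC).trans (good_cent H P (by rw [cardP H]; norm_num))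
  have hc2 : Nat.card K ∣ 2 ^ 5 * 13 ^ 2 :=
    Nat.Coprime.dvd_of_dvd_mul_left
      (((Nat.Prime.coprime_iff_not_dvd fact53.out).2 h53).symm.pow_right 3) hc1
  obtain ⟨q, hq⟩ := exists_prime_orderOf_dvd_card' (G := G) 409 (by rw [H.card]; norm_num)
  have h4 := fp_conj (zpowers q) K (IsPGroup.of_card (p := 409) (n := 1)
    (by rw [Nat.card_zpowers, hq, pow_one])) (by rw [normalizer_eq_top]; exact le_top)
  have h5 : Nat.card (K ⊓ centralizer ((zpowers q : Subgroup G) : Set G) : Subgroup G) = 1 := by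
    by_contra hne
    obtain ⟨r, hr, hrd⟩ := Nat.exists_prime_and_dvd hne
    have := Fact.mk hr
    obtain ⟨x, hx, hx2⟩ := cauchy_mem r _ hrd
    have h6 : r ∣ 2 ^ 5 * 13 ^ 2 := (hrd.trans (card_dvd_of_le inf_le_left)).trans hc2
    refine H.no409 r ?_ x q hx2 hq (mem_centralizer_iff.1 hx.2 q (mem_zpowers q)).symm
    rcases (Nat.Prime.dvd_mul hr).1 h6 with h | h
    · exact Or.inl ((Nat.prime_dvd_prime_iff_eq hr (by norm_num)).1 (hr.dvd_of_dvd_pow h))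
    · exact Or.inr ((Nat.prime_dvd_prime_iff_eq hr (by norm_num)).1 (hr.dvd_of_dvd_pow h))
  rw [h5] at h4
  have h6 : K = ⊥ := card_eq_one.1 (arithK _ hc2 h4)
  have : g ∈ K := (hKmem g).2 hg
  rw [h6] at this
  exact mem_bot.1 this

theorem geo (H : Hyp G) : Geo (G := G) (Ω := Vx G) vadj (fun U => U.1) where
  symm := fun h => ⟨h.1.symm, h.2.imp fun _ h => h.symm⟩
  irrefl := fun U h => h.1 rfl
  smul := by
    rintro g U V ⟨h, P, h1, h2⟩
    exact ⟨fun h' => h (smul_left_cancel g h'), g • P, smul_le_sylow g h1, smul_le_sylow g h2⟩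
  deg := vdeg H
  fixE := by
    rintro U V ⟨h, P, h1, h2⟩ v hv
    exact Vx.fix_iff.2 (norm_of_sq U.2.1 (cardP H P) h1 (h2 hv))
  fixV := fun V v hv => Vx.fix_iff.2 (le_normalizer hv)
  trans := vtrans H
  card := by
    rw [← V_card H]
    rfl
  edge := by
    rintro U V U' V' ⟨h, P, h1, h2⟩ ⟨h', P', h1', h2'⟩
    obtain ⟨g, hg⟩ := exists_smul_eq G P P'
    have a1 := smul_le_sylow g h1
    have a2 := smul_le_sylow g h2
    rw [hg] at a1 a2
    have hne : g • U ≠ g • V := fun h' => h (smul_left_cancel g h')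
    refine ⟨g, ?_⟩
    by_cases hc : g • U = U'
    · left
      refine ⟨hc, Subtype.ext ?_⟩
      rw [hc] at hne
      exact VP_eq H U'.2 (g • V).2 V'.2 h1' a2 h2' (Vx.ne hne) (Vx.ne h')
    · right
      have e1 : g • U = V' := Subtype.ext
        (VP_eq H U'.2 (g • U).2 V'.2 h1' a1 h2' (Vx.ne fun h => hc h.symm) (Vx.ne h'))
      refine ⟨e1, Subtype.ext ?_⟩
      rw [e1] at hne
      exact VP_eq H V'.2 (g • V).2 U'.2 h2' a2 h1' (Vx.ne hne) (Vx.ne h').symm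
  faithful := vfaithful H
  cardE := fun V => V.2.1
  noidx := by
    intro L hL
    have : L.Normal := normal_of_index_eq_two hL
    have h1 := card_mul_index L
    rw [hL, H.card] at h1
    have h2 : 409 ∣ Nat.card L := by
      refine Nat.Coprime.dvd_of_dvd_mul_right (n := 2) (by norm_num) ?_
      rw [h1]
      norm_num
    have := frattini H L h2
    rw [hL] at this
    norm_num at this
  fixW := by
    rintro U V W ⟨hUV, P, hUP, hVP⟩ ⟨hWU, A, hWA, hUA⟩ hWV v hv hvW
    have hPA : P ≠ A := by
      rintro rfl
      exact Vx.ne hWV (VP_eq H U.2 W.2 V.2 hUP hWA hVP (Vx.ne hWU).symm (Vx.ne hUV))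
    have hvU : v • U = U := Vx.fix_iff.2 (norm_of_sq U.2.1 (cardP H P) hUP (hVP hv))
    have hvA := fix_sylow H hWU hWA hUA hvW hvU
    have := mem_sylow_of_fix A V.1 (IsPGroup.of_card V.2.1) v hv hvA
    show v ∈ U.1
    rw [← inf_eq_of_sq H U.2.1 hPA hUP hUA]
    exact ⟨hVP hv, this⟩
  inf3 := fun hne h1 h2 v a b c => vinf3 H hne h1 h2 v a b c
  inf2 := by
    rintro U V ⟨hUV, P, hUP, hVP⟩
    rw [sq_inf_zz H U.2 V.2 hUP hVP (Vx.ne hUV), (U.2.zz H hUP).2]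

end
end OD

end

section
open Subgroup MulAction
open scoped Pointwise

namespace OD
namespace Geo

section
set_option linter.unusedSectionVars false
variable {G Ω : Type*} [Group G] [MulAction G Ω] [Finite G] [Finite Ω] {adj : Ω → Ω → Prop}
  {E : Ω → Subgroup G}

theorem ne (g : Geo adj E) {U V : Ω} (h : adj U V) : U ≠ V := fun h' => g.irrefl V (h' ▸ h)

theorem adj_iff (g : Geo adj E) (a : G) {U V : Ω} : adj (a • U) (a • V) ↔ adj U V := by
  refine ⟨fun h => ?_, g.smul a⟩
  have := g.smul a⁻¹ h
  rwa [inv_smul_smul, inv_smul_smul] at this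

theorem ex_nb (g : Geo adj E) (U : Ω) : ∃ V, adj U V := by
  have h : {W | adj U W}.Nonempty := by
    rw [← Set.ncard_pos, g.deg]; norm_num
  exact h

theorem ex_nb2 (g : Geo adj E) (U A B : Ω) : ∃ V, adj U V ∧ V ≠ A ∧ V ≠ B := by
  by_contra hc
  push Not at hc
  have h1 : {W | adj U W} ⊆ {A, B} := by
    intro W hW
    by_cases h : W = A
    · exact Or.inl h
    · exact Or.inr (hc W hW h)
  have h2 := Set.ncard_le_ncard h1
  have h3 := Set.ncard_insert_le A {B}
  rw [g.deg] at h2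
  rw [Set.ncard_singleton] at h3
  omega

theorem triangle_all (g : Geo adj E) {U V W : Ω} (h1 : adj U V) (h2 : adj V W) (h3 : adj U W) :
    ∀ {X Y}, adj U X → adj U Y → X ≠ Y → adj X Y := by
  have key : ∀ {V W}, adj U V → adj V W → adj U W → ∀ {X}, adj U X → X ≠ V → adj V X := by
    intro V W h1 h2 h3 X hX hne
    obtain ⟨v, hv, hvW⟩ := g.trans h1 h3 hX (g.ne h2).symm hne
    have := g.smul v h2
    rwa [g.fixV V v hv, hvW] at this
  intro X Y hX hY hne
  by_cases hXV : X = V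
  · subst hXV
    exact key h1 h2 h3 hY hne.symm
  · have := key h1 h2 h3 hX hXV
    exact key hX (g.symm this) h1 hY hne.symm

theorem no_triangle (g : Geo adj E) {U V W : Ω} (h1 : adj U V) (h2 : adj V W) : ¬ adj U W := by
  intro h3
  have hall : ∀ Z X Y : Ω, adj Z X → adj Z Y → X ≠ Y → adj X Y := by
    intro Z X Y hX hY hne
    obtain ⟨a, ⟨e1, e2⟩ | ⟨e1, e2⟩⟩ := g.edge h1 hX
    · subst e1 e2
      exact g.triangle_all (g.smul a h1) (g.smul a h2) (g.smul a h3) hX hY hne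
    · subst e1 e2
      exact g.triangle_all (g.smul a (g.symm h1)) (g.smul a h3) (g.smul a h2) hX hY hne
  let f : Ω → Set Ω := fun U => insert U {W | adj U W}
  have hf : ∀ x y, adj x y → f x ⊆ f y := by
    rintro x y hxy z (rfl | hz)
    · exact Or.inr (g.symm hxy)
    · by_cases hyz : y = z
      · exact Or.inl hyz.symm
      · exact Or.inr (hall x y z hxy hz hyz)
  have hcard : (Set.univ : Set Ω).ncard = (Set.range f).ncard * 55 := by
    refine fiber_count f _ _ 55 (fun a _ => ⟨a, rfl⟩) ?_
    rintro _ ⟨x, rfl⟩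
    have : {a ∈ (Set.univ : Set Ω) | f a = f x} = f x := by
      ext y
      constructor
      · rintro ⟨-, h⟩
        rw [← h]
        exact Or.inl rfl
      · rintro (rfl | h)
        · exact ⟨trivial, rfl⟩
        · exact ⟨trivial, Set.Subset.antisymm (hf _ _ (g.symm h)) (hf _ _ h)⟩
    rw [this]
    show (insert x {W | adj x W}).ncard = 55
    rw [Set.ncard_insert_of_notMem (show x ∉ {W | adj x W} from g.irrefl x), g.deg]
  rw [Set.ncard_univ, g.card] at hcard
  omega

theorem no_square (g : Geo adj E) {U V W X : Ω} (h1 : adj U V) (h2 : adj V W) (h3 : adj W X) (h4 : adj X U)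
    (hUW : U ≠ W) : V = X := by
  by_contra hVX
  have nb_smul : ∀ (a : G) {A B : Ω}, {Z | adj A Z} = {Z | adj B Z} →
      {Z | adj (a • A) Z} = {Z | adj (a • B) Z} := by
    intro a A B h
    ext Z
    have h' := Set.ext_iff.1 h (a⁻¹ • Z)
    have e1 := g.adj_iff a (U := A) (V := a⁻¹ • Z)
    have e2 := g.adj_iff a (U := B) (V := a⁻¹ • Z)
    rw [smul_inv_smul] at e1 e2
    show adj (a • A) Z ↔ adj (a • B) Z
    rw [e1, e2]
    exact h'
  have key : ∀ {U V W X : Ω}, adj U V → adj V W → adj W X → adj X U → U ≠ W → V ≠ X →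
      ∀ {Y}, adj V Y → {Z | adj U Z} = {Z | adj Y Z} := by
    intro U V W X h1 h2 h3 h4 hUW hVX Y hY
    have hs : {Z | adj U Z} = {Z | adj W Z} := by
      refine Set.eq_of_subset_of_ncard_le ?_ ?_ (Set.toFinite _)
      · intro Z hZ
        by_cases hZV : Z = V
        · subst hZV; exact g.symm h2
        · obtain ⟨v, hv, hvX⟩ := g.trans h1 (g.symm h4) hZ (Ne.symm hVX) hZV
          have := g.smul v h3
          rwa [hvX, g.fixE (g.symm h2) v hv] at this
      · rw [g.deg, g.deg]
    by_cases hYU : Y = U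
    · rw [hYU]
    · obtain ⟨u, hu, huW⟩ := g.trans (g.symm h1) h2 hY (Ne.symm hUW) hYU
      have := nb_smul u hs
      rwa [huW, g.fixV U u hu] at this
  have hall : ∀ A B Y : Ω, adj A B → adj B Y → {Z | adj A Z} = {Z | adj Y Z} := by
    intro A B Y hAB hBY
    obtain ⟨a, ⟨e1, e2⟩ | ⟨e1, e2⟩⟩ := g.edge h1 hAB
    · subst e1 e2
      exact key (g.smul a h1) (g.smul a h2) (g.smul a h3) (g.smul a h4)
        (fun h => hUW (smul_left_cancel a h)) (fun h => hVX (smul_left_cancel a h)) hBY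
    · subst e1 e2
      exact key (g.smul a (g.symm h1)) (g.smul a (g.symm h4)) (g.smul a (g.symm h3))
        (g.smul a (g.symm h2))
        (fun h => hVX (smul_left_cancel a h)) (fun h => hUW (smul_left_cancel a h)) hBY
  let f : Ω → Set Ω := fun U => {W | adj U W}
  have hcard : (Set.univ : Set Ω).ncard = (Set.range f).ncard * 54 := by
    refine fiber_count f _ _ 54 (fun a _ => ⟨a, rfl⟩) ?_
    rintro _ ⟨x, rfl⟩
    obtain ⟨v, hv⟩ := g.ex_nb x
    have : {a ∈ (Set.univ : Set Ω) | f a = f x} = {W | adj v W} := by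
      ext y
      constructor
      · rintro ⟨-, h⟩
        have : v ∈ f y := by rw [h]; exact hv
        exact g.symm this
      · intro h
        exact ⟨trivial, (hall x v y hv h).symm⟩
    rw [this, g.deg]
  rw [Set.ncard_univ, g.card] at hcard
  omega

/-- uniqueness of common neighbours -/
theorem nb_unique (g : Geo adj E) {U W V V' : Ω} (hne : U ≠ W) (h1 : adj U V) (h2 : adj V W) (h3 : adj U V')
    (h4 : adj V' W) : V = V' := g.no_square h1 h2 (g.symm h4) (g.symm h3) hne

end

/-- having a common neighbour -/
def col {Ω : Type*} (adj : Ω → Ω → Prop) (x y : Ω) : Prop := x = y ∨ ∃ z, adj x z ∧ adj z y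

/-- distance two -/
def D2 {Ω : Type*} (adj : Ω → Ω → Prop) (x : Ω) : Set Ω := {y | x ≠ y ∧ ∃ z, adj x z ∧ adj z y}

section
set_option linter.unusedSectionVars false
variable {G Ω : Type*} [Group G] [MulAction G Ω] [Finite G] [Finite Ω] {adj : Ω → Ω → Prop}
  {E : Ω → Subgroup G}

theorem D2_card (g : Geo adj E) (U : Ω) : (D2 adj U).ncard = 2862 := by
  classical
  have hex : ∀ W, ∃ V, W ∈ D2 adj U → adj U V ∧ adj V W := by
    intro W
    by_cases h : W ∈ D2 adj U
    · obtain ⟨_, V, hV⟩ := h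
      exact ⟨V, fun _ => hV⟩
    · exact ⟨U, fun h' => absurd h' h⟩
  choose f hf using hex
  have := fiber_count f (D2 adj U) {V | adj U V} 53 (fun W hW => (hf W hW).1) ?_
  · rw [this, g.deg]
  · intro V hV
    have : {a ∈ D2 adj U | f a = V} = {W | adj V W} \ {U} := by
      ext W
      constructor
      · rintro ⟨h1, rfl⟩
        exact ⟨(hf W h1).2, fun h => h1.1 h.symm⟩
      · rintro ⟨h1, h2⟩
        have hm : W ∈ D2 adj U := ⟨fun h => h2 h.symm, V, hV, h1⟩
        exact ⟨hm, g.nb_unique hm.1 (hf W hm).1 (hf W hm).2 hV h1⟩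
    rw [this, Set.ncard_sdiff_singleton_of_mem (show U ∈ {W | adj V W} from g.symm hV), g.deg]

theorem D2_smul (g : Geo adj E) (a : G) {U W : Ω} (h : W ∈ D2 adj U) : a • W ∈ D2 adj (a • U) := by
  obtain ⟨h1, V, h2, h3⟩ := h
  exact ⟨fun h => h1 (smul_left_cancel a h), a • V, g.smul a h2, g.smul a h3⟩

theorem D2_not_nb (g : Geo adj E) {U W : Ω} (h : W ∈ D2 adj U) : ¬ adj U W := by
  obtain ⟨h1, V, h2, h3⟩ := h
  exact g.no_triangle h2 h3

theorem D2_trans (g : Geo adj E) {U W W' : Ω} (h : W ∈ D2 adj U) (h' : W' ∈ D2 adj U) :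
    ∃ a : G, a • U = U ∧ a • W = W' := by
  obtain ⟨h1, V, h2, h3⟩ := h
  obtain ⟨h1', V', h2', h3'⟩ := h'
  obtain ⟨X, hX, hXV, hXV'⟩ := g.ex_nb2 U V V'
  obtain ⟨b, hb, hbV⟩ := g.trans hX h2 h2' hXV.symm hXV'.symm
  have hbU := g.fixE hX b hb
  have h4 : adj V' (b • W) := by rw [← hbV]; exact g.smul b h3
  have h5 : b • W ≠ U := by
    intro h
    rw [← hbU] at h
    exact h1 (smul_left_cancel b h).symm
  obtain ⟨c, hc, hcW⟩ := g.trans (g.symm h2') h4 h3' h5 h1'.symm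
  refine ⟨c * b, ?_, ?_⟩
  · rw [mul_smul, hbU, g.fixV U c hc]
  · rw [mul_smul, hcW]

/-- ball of radius 2 -/
theorem ball_card (g : Geo adj E) (U : Ω) : ({U} ∪ {W | adj U W} ∪ D2 adj U).ncard = 2917 := by
  rw [Set.ncard_union_eq, Set.ncard_union_eq, Set.ncard_singleton, g.deg, g.D2_card]
  · rw [Set.disjoint_left]
    rintro _ rfl h
    exact g.irrefl _ h
  · rw [Set.disjoint_left]
    rintro x (rfl | h) h'
    · exact h'.1 rfl
    · exact g.D2_not_nb h' h

theorem D2_no_edge (g : Geo adj E) {U W X : Ω} (hW : W ∈ D2 adj U) (hX : X ∈ D2 adj U) : ¬ adj W X := by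
  intro hWX
  let S : Ω → Set Ω := fun U => {U} ∪ {W | adj U W} ∪ D2 adj U
  have h1 : ∀ Y, adj W Y → Y ∈ S U := by
    intro Y hY
    obtain ⟨hne, V, h2, h3⟩ := hW
    by_cases hYV : Y = V
    · subst hYV; exact Or.inl (Or.inr h2)
    · obtain ⟨v, hv, hvX⟩ := g.trans (g.symm h3) hWX hY
        (fun h => g.D2_not_nb hX (h ▸ h2)) hYV
      have := g.D2_smul v hX
      rw [hvX, g.fixE h2 v hv] at this
      exact Or.inr this
  have hSmul : ∀ (a : G) {A B : Ω}, B ∈ S A → a • B ∈ S (a • A) := by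
    rintro a A B ((rfl | h) | h)
    · exact Or.inl (Or.inl rfl)
    · exact Or.inl (Or.inr (g.smul a h))
    · exact Or.inr (g.D2_smul a h)
  have hclosed : ∀ Z ∈ S U, ∀ Y, adj Z Y → Y ∈ S U := by
    rintro Z ((rfl | hZ) | hZ) Y hY
    · exact Or.inl (Or.inr hY)
    · by_cases hUY : U = Y
      · exact Or.inl (Or.inl hUY.symm)
      · exact Or.inr ⟨hUY, Z, hZ, hY⟩
    · obtain ⟨a, ha1, ha2⟩ := g.D2_trans hW hZ
      have h4 : adj W (a⁻¹ • Y) := by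
        rw [← g.adj_iff a, ha2, smul_inv_smul]; exact hY
      have := hSmul a (h1 _ h4)
      rwa [smul_inv_smul, ha1] at this
  have hex : ∃ Z, Z ∉ S U := by
    by_contra hc
    push Not at hc
    have : S U = Set.univ := Set.eq_univ_of_forall hc
    have h2 := g.ball_card U
    change (S U).ncard = 2917 at h2
    rw [this, Set.ncard_univ, g.card] at h2
    omega
  obtain ⟨Z, hZ⟩ := hex
  have hco : ∀ Z, Z ∉ S U → ∀ Y, adj Z Y → Y ∉ S U :=
    fun Z hZ Y hY h => hZ (hclosed Y h Z (g.symm hY))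
  obtain ⟨Y, hY⟩ := g.ex_nb Z
  obtain ⟨V, hV⟩ := g.ex_nb U
  have hsub : ∀ A, A ∉ S U → S A ⊆ (S U)ᶜ := by
    rintro A hA B ((rfl | h) | ⟨-, C, h1, h2⟩)
    · exact hA
    · exact hco _ hA _ h
    · exact hco _ (hco _ hA _ h1) _ h2
  have h2 := Set.ncard_le_ncard (hsub Z hZ)
  have h3 : (S Z).ncard = 2917 := g.ball_card Z
  have h4 : (S U).ncard = 2917 := g.ball_card U
  rw [Set.ncard_compl, g.card, h3, h4] at h2
  omega

end
end Geo
end OD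

end

section
open Subgroup MulAction
open scoped Pointwise

namespace OD
namespace Geo

section
set_option linter.unusedSectionVars false
variable {G Ω : Type*} [Group G] [MulAction G Ω] [Finite G] [Finite Ω] {adj : Ω → Ω → Prop}
  {E : Ω → Subgroup G}

theorem D3_nb (g : Geo adj E) {U Z Y : Ω} (hZ : Z ∉ {U} ∪ {W | adj U W} ∪ D2 adj U) (hY : adj Z Y) :
    Y ∈ D2 adj U := by
  set S := {U} ∪ {W | adj U W} ∪ D2 adj U with hS
  have hSc : (Sᶜ).ncard = 2809 := by rw [Set.ncard_compl, g.card, g.ball_card]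
  let T : Set (Ω × Ω) := {p | p.1 ∉ S ∧ adj p.1 p.2}
  let T' : Set (Ω × Ω) := {p | p.1 ∉ S ∧ adj p.1 p.2 ∧ p.2 ∈ D2 adj U}
  have h1 : T.ncard = 2809 * 54 := by
    rw [← hSc]
    refine fiber_count Prod.fst T Sᶜ 54 (fun p hp => hp.1) ?_
    intro b hb
    have : {a ∈ T | a.1 = b} = (fun y => (b, y)) '' {W | adj b W} := by
      ext ⟨x, y⟩
      constructor
      · rintro ⟨h, rfl⟩
        exact ⟨y, h.2, rfl⟩
      · rintro ⟨z, hz, h⟩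
        simp only [Prod.mk.injEq] at h
        obtain ⟨rfl, rfl⟩ := h
        exact ⟨⟨hb, hz⟩, rfl⟩
    rw [this, Set.InjOn.ncard_image, g.deg]
    intro x _ y _ h
    exact (Prod.mk.inj h).2
  have h2 : T'.ncard = 2862 * 53 := by
    rw [← g.D2_card U]
    refine fiber_count Prod.snd T' (D2 adj U) 53 (fun p hp => hp.2.2) ?_
    intro W hW
    obtain ⟨hne, V, hV, hVW⟩ := id hW
    have : {a ∈ T' | a.2 = W} = (fun x => (x, W)) '' ({X | adj W X} \ {V}) := by
      ext ⟨x, y⟩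
      constructor
      · rintro ⟨h, rfl⟩
        refine ⟨x, ⟨g.symm h.2.1, ?_⟩, rfl⟩
        rintro rfl
        exact h.1 (Or.inl (Or.inr hV))
      · rintro ⟨z, ⟨hz, hzV⟩, h⟩
        simp only [Prod.mk.injEq] at h
        obtain ⟨rfl, rfl⟩ := h
        refine ⟨⟨?_, g.symm hz, hW⟩, rfl⟩
        rintro ((h | h) | h)
        · exact g.D2_not_nb hW (h ▸ g.symm hz)
        · exact hzV (g.nb_unique hne h (g.symm hz) hV hVW)
        · exact g.D2_no_edge hW h hz
    rw [this, Set.InjOn.ncard_image,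
      Set.ncard_sdiff_singleton_of_mem (show V ∈ {X | adj W X} from g.symm hVW), g.deg]
    intro x _ y _ h
    exact (Prod.mk.inj h).1
  have h3 : T' = T := by
    refine Set.eq_of_subset_of_ncard_le (fun p hp => ⟨hp.1, hp.2.1⟩) ?_ (Set.toFinite _)
    rw [h1, h2]
  have h4 : ((Z, Y) : Ω × Ω) ∈ T := ⟨hZ, hY⟩
  rw [← h3] at h4
  exact h4.2.2

theorem col_iff (g : Geo adj E) {U x : Ω} : col adj U x ↔ x = U ∨ x ∈ D2 adj U := by
  constructor
  · rintro (h | h)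
    · exact Or.inl h.symm
    · by_cases h' : U = x
      · exact Or.inl h'.symm
      · exact Or.inr ⟨h', h⟩
  · rintro (h | h)
    · exact Or.inl h.symm
    · exact Or.inr h.2

theorem col_symm (g : Geo adj E) {x y : Ω} (h : col adj x y) : col adj y x := by
  rcases h with h | ⟨z, h1, h2⟩
  · exact Or.inl h.symm
  · exact Or.inr ⟨z, g.symm h2, g.symm h1⟩

theorem col_adj (g : Geo adj E) {U x y : Ω} (h : adj x y) : col adj U x ↔ ¬ col adj U y := by
  have key : ∀ {x y : Ω}, adj x y → col adj U x → ¬ col adj U y := by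
    intro x y h hx hy
    rw [g.col_iff] at hx hy
    rcases hx with rfl | hx <;> rcases hy with rfl | hy
    · exact g.irrefl _ h
    · exact g.D2_not_nb hy h
    · exact g.D2_not_nb hx (g.symm h)
    · exact g.D2_no_edge hx hy h
  refine ⟨key h, fun hy => ?_⟩
  rw [g.col_iff] at hy ⊢
  by_cases hUy : adj U y
  · by_cases hx : x = U
    · exact Or.inl hx
    · exact Or.inr ⟨Ne.symm hx, y, hUy, g.symm h⟩
  · refine Or.inr (g.D3_nb ?_ (g.symm h))
    rintro ((h' | h') | h')
    · exact hy (Or.inl h')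
    · exact hUy h'
    · exact hy (Or.inr h')

theorem col_refl (g : Geo adj E) (x : Ω) : col adj x x := Or.inl rfl

theorem adj_not_col (g : Geo adj E) {x y : Ω} (h : adj x y) : ¬ col adj x y :=
  (g.col_adj h).1 (g.col_refl x)

theorem col_trans (g : Geo adj E) {x y z : Ω} (h1 : col adj x y) (h2 : col adj y z) : col adj x z := by
  rcases h2 with rfl | ⟨w, hw, hw'⟩
  · exact h1
  · have := (g.col_adj (U := x) hw).1 h1
    have h3 := g.col_adj (U := x) hw'
    by_contra h
    exact this (h3.2 h)

theorem col_card (g : Geo adj E) (x : Ω) : {y | col adj x y}.ncard = 2863 := by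
  have : {y | col adj x y} = insert x (D2 adj x) := by
    ext y; exact g.col_iff
  rw [this, Set.ncard_insert_of_notMem (fun h => h.1 rfl), g.D2_card]

theorem not_col (g : Geo adj E) {x y z : Ω} (h1 : ¬ col adj x y) (h2 : ¬ col adj x z) : col adj y z := by
  have hsub : {w | col adj y w} ⊆ {w | col adj x w}ᶜ := by
    intro w hw hw'
    exact h1 (g.col_trans hw' (g.col_symm hw))
  have : {w | col adj y w} = {w | col adj x w}ᶜ := by
    refine Set.eq_of_subset_of_ncard_le hsub ?_ (Set.toFinite _)
    rw [Set.ncard_compl, g.card, g.col_card, g.col_card]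
  have h3 : z ∈ {w | col adj x w}ᶜ := h2
  rw [← this] at h3
  exact h3

theorem col_smul_iff (g : Geo adj E) (a : G) {x y : Ω} : col adj (a • x) (a • y) ↔ col adj x y := by
  have key : ∀ (a : G) {x y : Ω}, col adj x y → col adj (a • x) (a • y) := by
    rintro a x y (rfl | ⟨z, h1, h2⟩)
    · exact Or.inl rfl
    · exact Or.inr ⟨a • z, g.smul a h1, g.smul a h2⟩
  refine ⟨fun h => ?_, key a⟩
  have := key a⁻¹ h
  rwa [inv_smul_smul, inv_smul_smul] at this

theorem D3_card (g : Geo adj E) (V : Ω) : {x | ¬ col adj V x ∧ ¬ adj V x}.ncard = 2809 := by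
  have : {x | ¬ col adj V x ∧ ¬ adj V x} = ({V} ∪ {W | adj V W} ∪ D2 adj V)ᶜ := by
    ext x
    show (_ ∧ _) ↔ ¬ ((x = V ∨ adj V x) ∨ x ∈ D2 adj V)
    rw [g.col_iff]
    tauto
  rw [this, Set.ncard_compl, g.card, g.ball_card]

theorem col_smul (g : Geo adj E) (a : G) (x : Ω) : col adj x (a • x) := by
  by_contra hc
  let L : Subgroup G :=
    { carrier := {a | col adj x (a • x)}
      one_mem' := by show col adj x ((1 : G) • x); rw [one_smul]; exact g.col_refl x
      mul_mem' := by
        intro a b ha hb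
        show col adj x ((a * b) • x)
        rw [mul_smul]
        exact g.col_trans ha ((g.col_smul_iff a).2 hb)
      inv_mem' := by
        intro a ha
        show col adj x (a⁻¹ • x)
        rw [← g.col_smul_iff a, smul_inv_smul]
        exact g.col_symm ha }
  apply g.noidx L
  rw [Subgroup.index_eq_two_iff]
  have hm : ∀ b, b ∈ L ↔ col adj x (b • x) := fun b => Iff.rfl
  have hac : ¬ col adj x (a⁻¹ • x) := by
    rw [← g.col_smul_iff a, smul_inv_smul]
    exact fun h => hc (g.col_symm h)
  refine ⟨a⁻¹, fun b => ?_⟩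
  have h1 : col adj x ((b * a⁻¹) • x) ↔ ¬ col adj x (b • x) := by
    rw [mul_smul]
    constructor
    · intro h h'
      have := g.col_trans (g.col_symm h') h
      rw [g.col_smul_iff] at this
      exact hac this
    · intro h
      by_contra h'
      have := g.not_col h h'
      rw [g.col_smul_iff] at this
      exact hac this
  rw [hm, hm, h1]
  by_cases h : col adj x (b • x)
  · exact Or.inr ⟨h, not_not.2 h⟩
  · exact Or.inl ⟨h, h⟩

end
end Geo
end OD

end

section
open Subgroup MulAction
open scoped Pointwise

namespace OD
namespace Geo

/-- affine points -/
def aff {Ω : Type*} (adj : Ω → Ω → Prop) (V x : Ω) : Prop := ¬ col adj V x ∧ ¬ adj V x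

section
set_option linter.unusedSectionVars false
variable {G Ω : Type*} [Group G] [MulAction G Ω] [Finite G] [Finite Ω] {adj : Ω → Ω → Prop}
  {E : Ω → Subgroup G}

theorem line_meet (g : Geo adj E) {V x L : Ω} (hx : aff adj V x) (hL : adj x L) :
    L ≠ V ∧ ∃ U, adj V U ∧ adj U L := by
  have h1 : L ≠ V := by
    rintro rfl
    exact hx.2 (g.symm hL)
  have h2 : col adj V L := by
    by_contra h
    exact hx.1 ((g.col_adj hL).2 h)
  rcases h2 with h2 | h2
  · exact absurd h2.symm h1
  · exact ⟨h1, h2⟩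

theorem aff_smul (g : Geo adj E) {V x : Ω} (hx : aff adj V x) {v : G} (hv : v ∈ E V) : aff adj V (v • x) := by
  have hV := g.fixV V v hv
  refine ⟨fun h => hx.1 ?_, fun h => hx.2 ?_⟩
  · rw [← hV, g.col_smul_iff] at h
    exact h
  · rw [← hV, g.adj_iff] at h
    exact h

theorem aff_free (g : Geo adj E) {V x : Ω} (hx : aff adj V x) {v : G} (hv : v ∈ E V) (hvx : v • x = x) :
    v = 1 := by
  have key : ∀ L, adj x L → ∃ U, adj V U ∧ adj U L ∧ v ∈ E U := by
    intro L hL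
    obtain ⟨h1, U, hU, hUL⟩ := g.line_meet hx hL
    refine ⟨U, hU, hUL, ?_⟩
    have hvU : v • U = U := g.fixE (g.symm hU) v hv
    have hUx : U ≠ x := by
      rintro rfl
      exact hx.2 hU
    have h3 := g.smul v hUL
    have h4 := g.smul v hL
    rw [hvU] at h3
    rw [hvx] at h4
    have h5 : L = v • L := g.nb_unique hUx hUL (g.symm hL) h3 (g.symm h4)
    exact g.fixW (g.symm hU) (g.symm hUL) h1 v hv h5.symm
  obtain ⟨L1, hL1⟩ := g.ex_nb x
  obtain ⟨L2, hL2, hne, -⟩ := g.ex_nb2 x L1 L1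
  obtain ⟨U1, a1, b1, c1⟩ := key L1 hL1
  obtain ⟨U2, a2, b2, c2⟩ := key L2 hL2
  refine g.inf3 (U := U1) (U' := U2) (V := V) ?_ (g.symm a1) (g.symm a2) v c1 c2 hv
  rintro rfl
  have hUx : U1 ≠ x := by
    rintro rfl
    exact hx.2 a1
  exact hne (g.nb_unique hUx b2 (g.symm hL2) b1 (g.symm hL1))

theorem aff_inj (g : Geo adj E) {V x : Ω} (hx : aff adj V x) {a b : G} (ha : a ∈ E V) (hb : b ∈ E V)
    (h : a • x = b • x) : a = b := by
  have : b⁻¹ * a = 1 := by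
    apply g.aff_free hx (mul_mem (inv_mem hb) ha)
    rw [mul_smul, h, inv_smul_smul]
  exact (inv_mul_eq_one.1 this).symm

theorem aff_trans (g : Geo adj E) {V x y : Ω} (hx : aff adj V x) (hy : aff adj V y) : ∃ a ∈ E V, a • x = y := by
  have h1 : (fun a : G => a • x) '' (E V : Set G) = {y | aff adj V y} := by
    refine Set.eq_of_subset_of_ncard_le ?_ ?_ (Set.toFinite _)
    · rintro _ ⟨a, ha, rfl⟩
      exact g.aff_smul hx ha
    · have h2 : {y | aff adj V y}.ncard = 2809 := g.D3_card V
      have h3 : (E V : Set G).ncard = 53 ^ 2 := g.cardE V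
      rw [h2, Set.InjOn.ncard_image, h3]
      · norm_num
      · intro a ha b hb h
        exact g.aff_inj hx ha hb h
  have h2 : y ∈ {y | aff adj V y} := hy
  rw [← h1] at h2
  exact h2

theorem line_aff (g : Geo adj E) {V U L x : Ω} (hUV : adj U V) (hL : adj L U) (hLV : L ≠ V) (hx : adj L x)
    (hxU : x ≠ U) : aff adj V x := by
  have hcol : col adj V L := Or.inr ⟨U, g.symm hUV, g.symm hL⟩
  refine ⟨(g.col_adj hx).1 hcol, fun h => hxU ?_⟩
  exact g.nb_unique (Ne.symm hLV) h (g.symm hx) (g.symm hUV) (g.symm hL)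

theorem line_trans (g : Geo adj E) {V U L x y : Ω} (hUV : adj U V) (hL : adj L U) (hLV : L ≠ V) (hx : adj L x)
    (hxU : x ≠ U) (hy : adj L y) (hyU : y ≠ U) : ∃ a, a ∈ E U ∧ a ∈ E V ∧ a • x = y := by
  have hax := g.line_aff hUV hL hLV hx hxU
  have h1 : (fun a : G => a • x) '' ((E U ⊓ E V : Subgroup G) : Set G) = {W | adj L W} \ {U} := by
    refine Set.eq_of_subset_of_ncard_le ?_ ?_ (Set.toFinite _)
    · rintro _ ⟨a, ha, rfl⟩
      refine ⟨?_, ?_⟩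
      · have := g.smul a hx
        rw [g.fixE hL a ha.1] at this
        exact this
      · intro h
        have h : a • x = U := h
        rw [← g.fixV U a ha.1] at h
        exact hxU (smul_left_cancel a h)
    · have h3 : ((E U ⊓ E V : Subgroup G) : Set G).ncard = 53 := g.inf2 hUV
      rw [Set.ncard_sdiff_singleton_of_mem (show U ∈ {W | adj L W} from hL), g.deg,
        Set.InjOn.ncard_image, h3]
      intro a ha b hb h
      exact g.aff_inj hax ha.2 hb.2 h
  have h2 : y ∈ {W | adj L W} \ {U} := ⟨hy, hyU⟩
  rw [← h1] at h2
  obtain ⟨a, ha, h⟩ := h2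
  exact ⟨a, ha.1, ha.2, h⟩

theorem line_smul (g : Geo adj E) {U L x : Ω} (hL : adj L U) {a : G} (ha : a ∈ E U) (hx : adj L x) :
    adj L (a • x) := by
  have := g.smul a hx
  rwa [g.fixE hL a ha] at this

theorem ex_aff (g : Geo adj E) (V : Ω) : ∃ x, aff adj V x := by
  have h2 : {y | aff adj V y}.ncard = 2809 := g.D3_card V
  have : {y | aff adj V y}.Nonempty := by
    rw [← Set.ncard_pos, h2]; norm_num
  exact this

theorem cover (g : Geo adj E) {V : Ω} {a : G} (ha : a ∈ E V) : ∃ U, adj V U ∧ a ∈ E U := by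
  obtain ⟨O, hO⟩ := g.ex_aff V
  by_cases h1 : a • O = O
  · have := g.aff_free hO ha h1
    obtain ⟨U, hU⟩ := g.ex_nb V
    exact ⟨U, hU, this ▸ one_mem _⟩
  · have hO' := g.aff_smul hO ha
    rcases g.not_col hO.1 hO'.1 with h | ⟨L, hL1, hL2⟩
    · exact absurd h.symm h1
    · obtain ⟨hLV, U, hU, hUL⟩ := g.line_meet hO hL1
      obtain ⟨b, hb1, hb2, hb⟩ := g.line_trans (g.symm hU) (g.symm hUL) hLV (g.symm hL1)
        (fun h => hO.2 (h ▸ hU)) hL2 (fun h => hO'.2 (h ▸ hU))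
      have := g.aff_inj hO ha hb2 hb.symm
      exact ⟨U, hU, this ▸ hb1⟩

theorem exp53 (g : Geo adj E) {V : Ω} {a : G} (ha : a ∈ E V) : a ^ 53 = 1 := by
  obtain ⟨U, hU, haU⟩ := g.cover ha
  have h := g.inf2 (g.symm hU)
  have h1 : (⟨a, haU, ha⟩ : (E U ⊓ E V : Subgroup G)) ^ 53 = 1 := by
    rw [← h]; exact pow_card_eq_one'
  simpa [Subtype.ext_iff] using h1

theorem ex_gen (g : Geo adj E) {V U : Ω} (hU : adj V U) : ∃ d : G, d ∈ E V ∧ d ≠ 1 ∧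
    (∀ a, a ∈ E V → (a ∈ E U ↔ ∃ n : ℕ, a = d ^ n)) := by
  have h := g.inf2 (g.symm hU)
  haveI : Fact (Nat.Prime 53) := ⟨by norm_num⟩
  haveI : Nontrivial (E U ⊓ E V : Subgroup G) := by
    rw [← Finite.one_lt_card_iff_nontrivial, h]; norm_num
  obtain ⟨⟨d, hd⟩, hd1⟩ := exists_ne (1 : (E U ⊓ E V : Subgroup G))
  refine ⟨d, hd.2, fun h => hd1 (Subtype.ext h), fun a ha => ⟨fun haU => ?_, ?_⟩⟩
  · have := mem_powers_of_prime_card (p := 53) h hd1 (g' := ⟨a, haU, ha⟩)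
    obtain ⟨n, hn⟩ := this
    exact ⟨n, by simpa using (congrArg Subtype.val hn).symm⟩
  · rintro ⟨n, rfl⟩
    exact pow_mem hd.1 n

end
end Geo

theorem coord (A : Type*) [Group A] [Finite A] (h : Nat.card A = 53 ^ 2) (he : ∀ a : A, a ^ 53 = 1) :
    ∃ c : A → Fin 2 → ZMod 53, Function.Bijective c ∧ ∀ a b, c (a * b) = c a + c b := by
  haveI : Fact (Nat.Prime 53) := ⟨by norm_num⟩
  haveI := IsPGroup.isMulCommutative_of_card_eq_prime_sq h
  letI : CommGroup A := { ‹Group A› with mul_comm := fun a b => mul_comm' a b }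
  letI : Module (ZMod 53) (Additive A) := AddCommGroup.zmodModule (n := 53) (fun x => by
    rw [← ofMul_toMul x, ← ofMul_pow, he, ofMul_one])
  haveI : Finite (Additive A) := ‹Finite A›
  haveI : Module.Finite (ZMod 53) (Additive A) := Module.Finite.of_finite
  have hr : Module.finrank (ZMod 53) (Additive A) = 2 := by
    have h1 := Module.natCard_eq_pow_finrank (K := ZMod 53) (V := Additive A)
    have h2 : Nat.card (Additive A) = 53 ^ 2 := h
    rw [h2, Nat.card_zmod] at h1
    exact (Nat.pow_right_injective (le_refl 2 |>.trans (by norm_num)) h1).symm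
  have e : Additive A ≃ₗ[ZMod 53] (Fin 2 → ZMod 53) :=
    LinearEquiv.ofFinrankEq _ _ (by rw [hr]; simp)
  exact ⟨fun a => e (Additive.ofMul a), e.bijective.comp Additive.ofMul.bijective,
    fun a b => map_add e (Additive.ofMul a) (Additive.ofMul b)⟩

end OD

end

section

namespace OD


/-- explicit 3 by 3 determinant -/
def dt (u v w : Fin 3 → ZMod 53) : ZMod 53 :=
  u 0 * (v 1 * w 2 - v 2 * w 1) - u 1 * (v 0 * w 2 - v 2 * w 0) + u 2 * (v 0 * w 1 - v 1 * w 0)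

/-- explicit proportionality -/
def prp (u v : Fin 3 → ZMod 53) : Prop := ∃ c : ZMod 53, c ≠ 0 ∧ u = c • v

section
variable {t : (Fin 3 → ZMod 53) → (Fin 3 → ZMod 53)}

theorem ftpg_norm (h0 : ∀ w, t w = 0 ↔ w = 0) (hd : ∀ u v w, dt u v w = 0 → dt (t u) (t v) (t w) = 0)
    (e0 : prp (t ![1, 0, 0]) ![1, 0, 0]) (e1 : prp (t ![0, 1, 0]) ![0, 1, 0])
    (e2 : prp (t ![0, 0, 1]) ![0, 0, 1]) (e3 : prp (t ![1, 1, 1]) ![1, 1, 1]) :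
    ∀ w, w ≠ 0 → prp (t w) w := by
  -- replacing
  have key : ∀ {u v u' v' : Fin 3 → ZMod 53}, prp (t u) u' → prp (t v) v' → ∀ w, dt u v w = 0 →
      dt u' v' (t w) = 0 := by
    rintro u v u' v' ⟨c, hc, h1⟩ ⟨c', hc', h2⟩ w h
    have h3 := hd u v w h
    rw [h1, h2] at h3
    have h4 : dt (c • u') (c' • v') (t w) = c * c' * dt u' v' (t w) := by
      simp only [dt, Pi.smul_apply, smul_eq_mul]; ring
    rw [h4] at h3
    exact (mul_eq_zero.1 h3).resolve_left (mul_ne_zero hc hc')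
  have build : ∀ w : Fin 3 → ZMod 53, w ≠ 0 → ∀ w' : Fin 3 → ZMod 53, (∃ c : ZMod 53, t w = c • w') →
      prp (t w) w' := by
    rintro w hw w' ⟨c, hc⟩
    refine ⟨c, ?_, hc⟩
    rintro rfl
    rw [zero_smul, h0] at hc
    exact hw hc
  have nz : ∀ x y z : ZMod 53, (x ≠ 0 ∨ y ≠ 0 ∨ z ≠ 0) → (![x, y, z] : Fin 3 → ZMod 53) ≠ 0 := by
    intro x y z h h'
    have a := congrFun h' 0
    have b := congrFun h' 1
    have c := congrFun h' 2
    simp at a b c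
    tauto
  have ext3 : ∀ (u : Fin 3 → ZMod 53) (c x y z : ZMod 53), u 0 = c * x → u 1 = c * y → u 2 = c * z →
      u = c • ![x, y, z] := by
    intro u c x y z h1 h2 h3
    ext i
    fin_cases i <;> simp [h1, h2, h3]
  have q : prp (t ![1, 1, 0]) ![1, 1, 0] := by
    apply build _ (nz _ _ _ (by simp))
    have a := key e0 e1 ![1, 1, 0] (by simp [dt])
    have b := key e2 e3 ![1, 1, 0] (by simp [dt])
    simp [dt] at a b
    exact ⟨t ![1, 1, 0] 0, ext3 _ _ _ _ _ (by ring) (by linear_combination b) (by rw [a]; ring)⟩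
  have hx : ∀ n : ℕ, prp (t ![(n : ZMod 53), 0, 1]) ![(n : ZMod 53), 0, 1] := by
    intro n
    induction n with
    | zero => simpa using e2
    | succ n ih =>
      have i1 : prp (t ![(n : ZMod 53) + 1, 1, 1]) ![(n : ZMod 53) + 1, 1, 1] := by
        apply build _ (nz _ _ _ (by simp))
        have a := key q ih ![(n : ZMod 53) + 1, 1, 1] (by simp [dt])
        have b := key e0 e3 ![(n : ZMod 53) + 1, 1, 1] (by simp [dt])
        simp [dt] at a b
        exact ⟨_, ext3 _ (t ![(n : ZMod 53) + 1, 1, 1] 1) _ _ _ (by linear_combination a + n * b)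
          (by ring) (by linear_combination b)⟩
      push_cast
      apply build _ (nz _ _ _ (by simp))
      have a := key e1 i1 ![(n : ZMod 53) + 1, 0, 1] (by simp [dt])
      have b := key e0 e2 ![(n : ZMod 53) + 1, 0, 1] (by simp [dt])
      simp [dt] at a b
      exact ⟨_, ext3 _ (t ![(n : ZMod 53) + 1, 0, 1] 2) _ _ _ (by linear_combination a)
          (by rw [b]; ring) (by ring)⟩
  have hx' : ∀ x : ZMod 53, prp (t ![x, 0, 1]) ![x, 0, 1] := by
    intro x
    have := hx x.val
    rwa [ZMod.natCast_zmod_val] at this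
  have hxx : ∀ x : ZMod 53, prp (t ![x, x, 1]) ![x, x, 1] := by
    intro x
    apply build _ (nz _ _ _ (by simp))
    have a := key e2 e3 ![x, x, 1] (by simp [dt])
    have b := key e1 (hx' x) ![x, x, 1] (by simp [dt])
    simp [dt] at a b
    exact ⟨_, ext3 _ (t ![x, x, 1] 2) _ _ _ (by linear_combination b)
      (by linear_combination a + b) (by ring)⟩
  have hy : ∀ x : ZMod 53, prp (t ![0, x, 1]) ![0, x, 1] := by
    intro x
    apply build _ (nz _ _ _ (by simp))
    have a := key e1 e2 ![0, x, 1] (by simp [dt])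
    have b := key e0 (hxx x) ![0, x, 1] (by simp [dt])
    simp [dt] at a b
    exact ⟨_, ext3 _ (t ![0, x, 1] 2) _ _ _ (by rw [a]; ring)
      (by linear_combination -b) (by ring)⟩
  have gen : ∀ x y z : ZMod 53, z ≠ 0 → prp (t ![x, y, z]) ![x, y, z] := by
    intro x y z hz
    apply build _ (nz _ _ _ (by simp [hz]))
    have a := key e1 (hx' (x / z)) ![x, y, z] (by simp [dt]; field_simp; ring)
    have b := key e0 (hy (y / z)) ![x, y, z] (by simp [dt]; field_simp; ring)
    simp [dt] at a b
    refine ⟨_, ext3 _ (t ![x, y, z] 2 / z) _ _ _ ?_ ?_ (by field_simp)⟩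
    · linear_combination a
    · linear_combination -b
  intro w hw
  have hw3 : w = ![w 0, w 1, w 2] := by
    ext i; fin_cases i <;> rfl
  by_cases hz : w 2 = 0
  · rw [hz] at hw3
    rw [hw3]
    generalize w 0 = x at hw3
    generalize w 1 = y at hw3
    rw [hw3] at hw
    apply build _ hw
    have a := key e0 e1 ![x, y, 0] (by simp [dt])
    have b := key e2 (gen x y 1 one_ne_zero) ![x, y, 0] (by simp [dt]; ring)
    simp [dt] at a b
    by_cases h : x = 0
    · have hy0 : y ≠ 0 := by
        rintro rfl
        apply hw
        rw [h]
        ext i; fin_cases i <;> rfl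
      refine ⟨_, ext3 _ (t ![x, y, 0] 1 / y) _ _ _ ?_ (by field_simp) (by rw [a]; ring)⟩
      field_simp
      linear_combination -b
    · refine ⟨_, ext3 _ (t ![x, y, 0] 0 / x) _ _ _ (by field_simp) ?_ (by rw [a]; ring)⟩
      field_simp
      linear_combination b
  · rw [hw3]
    exact gen _ _ _ hz

end
end OD

end

section

namespace OD
open Matrix

theorem dt_mulVec (M : Matrix (Fin 3) (Fin 3) (ZMod 53)) (u v w : Fin 3 → ZMod 53) :
    dt (M *ᵥ u) (M *ᵥ v) (M *ᵥ w) = M.det * dt u v w := by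
  simp only [dt, mulVec, dotProduct, Fin.sum_univ_three, Matrix.det_fin_three]
  ring

theorem pow105 (d : ZMod 53) : d ^ 105 = d := by
  have h : d ^ 53 = d := ZMod.pow_card d
  calc d ^ 105 = d ^ 53 * d ^ 52 := by ring
    _ = d ^ 53 := by rw [h, ← pow_succ', h]
    _ = d := h

set_option maxHeartbeats 1000000 in
theorem ftpg {s : (Fin 3 → ZMod 53) → (Fin 3 → ZMod 53)} (h0 : ∀ w, s w = 0 ↔ w = 0)
    (hd : ∀ u v w, dt u v w = 0 ↔ dt (s u) (s v) (s w) = 0) :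
    ∃ M : SpecialLinearGroup (Fin 3) (ZMod 53), ∀ w, w ≠ 0 → prp (s w) (M.1 *ᵥ w) := by
  set B : Matrix (Fin 3) (Fin 3) (ZMod 53) :=
    Matrix.of fun i j => (![s ![1, 0, 0], s ![0, 1, 0], s ![0, 0, 1]] : Fin 3 → Fin 3 → ZMod 53) j i
    with hB
  have hBdet : B.det = dt (s ![1, 0, 0]) (s ![0, 1, 0]) (s ![0, 0, 1]) := by
    simp [hB, Matrix.det_fin_three, dt]; ring
  have hB0 : B.det ≠ 0 := by
    rw [hBdet, Ne, ← hd]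
    simp [dt]
  have hBu : IsUnit B.det := isUnit_iff_ne_zero.2 hB0
  set c := B⁻¹ *ᵥ s ![1, 1, 1] with hc
  have hBc : B *ᵥ c = s ![1, 1, 1] := by
    rw [hc, mulVec_mulVec, mul_nonsing_inv _ hBu, one_mulVec]
  have hBe0 : B *ᵥ ![1, 0, 0] = s ![1, 0, 0] := by
    ext i; fin_cases i <;> simp [hB, mulVec, dotProduct, Fin.sum_univ_three]
  have hBe1 : B *ᵥ ![0, 1, 0] = s ![0, 1, 0] := by
    ext i; fin_cases i <;> simp [hB, mulVec, dotProduct, Fin.sum_univ_three]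
  have hBe2 : B *ᵥ ![0, 0, 1] = s ![0, 0, 1] := by
    ext i; fin_cases i <;> simp [hB, mulVec, dotProduct, Fin.sum_univ_three]
  have hc0 : c 0 ≠ 0 := by
    intro h
    have h1 := (hd ![0, 1, 0] ![0, 0, 1] ![1, 1, 1]).2 (by
      rw [← hBe1, ← hBe2, ← hBc, dt_mulVec]; simp [dt, h])
    simp [dt] at h1
  have hc1 : c 1 ≠ 0 := by
    intro h
    have h1 := (hd ![1, 0, 0] ![0, 0, 1] ![1, 1, 1]).2 (by
      rw [← hBe0, ← hBe2, ← hBc, dt_mulVec]; simp [dt, h])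
    simp [dt] at h1
  have hc2 : c 2 ≠ 0 := by
    intro h
    have h1 := (hd ![1, 0, 0] ![0, 1, 0] ![1, 1, 1]).2 (by
      rw [← hBe0, ← hBe1, ← hBc, dt_mulVec]; simp [dt, h])
    simp [dt] at h1
  set M := B * Matrix.diagonal c with hM
  have hM0 : M.det ≠ 0 := by
    rw [hM, det_mul, det_diagonal, Fin.prod_univ_three]
    exact mul_ne_zero hB0 (mul_ne_zero (mul_ne_zero hc0 hc1) hc2)
  have hMu : IsUnit M.det := isUnit_iff_ne_zero.2 hM0
  have hMt : ∀ w, M *ᵥ (M⁻¹ *ᵥ s w) = s w := fun w => by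
    rw [mulVec_mulVec, mul_nonsing_inv _ hMu, one_mulVec]
  have hinv : ∀ v w, M *ᵥ v = s w → M⁻¹ *ᵥ s w = v := fun v w h => by
    rw [← h, mulVec_mulVec, nonsing_inv_mul _ hMu, one_mulVec]
  have main := ftpg_norm (t := fun w => M⁻¹ *ᵥ s w) ?_ ?_ ?_ ?_ ?_ ?_
  · obtain ⟨k, hk3⟩ : ∃ k : ZMod 53, k ^ 3 = M.det :=
      ⟨M.det ^ 35, by rw [← pow_mul]; exact pow105 _⟩
    have hk0 : k ≠ 0 := by
      rintro rfl
      exact hM0 (by rw [← hk3]; ring)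
    refine ⟨⟨k⁻¹ • M, ?_⟩, ?_⟩
    · rw [det_smul, Fintype.card_fin, inv_pow, hk3, inv_mul_cancel₀ hM0]
    · intro w hw
      obtain ⟨d, hd0, h⟩ := main w hw
      refine ⟨d * k, mul_ne_zero hd0 hk0, ?_⟩
      show s w = (d * k) • ((k⁻¹ • M) *ᵥ w)
      rw [← hMt w, show M⁻¹ *ᵥ s w = d • w from h, mulVec_smul, smul_mulVec, smul_smul, mul_assoc, mul_inv_cancel₀ hk0, mul_one]
  · intro w
    constructor
    · intro h
      have := hMt w
      rw [show M⁻¹ *ᵥ s w = 0 from h, mulVec_zero] at this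
      exact (h0 w).1 this.symm
    · rintro rfl
      show M⁻¹ *ᵥ s 0 = 0
      rw [(h0 0).2 rfl, mulVec_zero]
  · intro u v w h
    rw [hd, ← hMt u, ← hMt v, ← hMt w, dt_mulVec] at h
    exact (mul_eq_zero.1 h).resolve_left hM0
  · refine ⟨(c 0)⁻¹, inv_ne_zero hc0, hinv _ _ ?_⟩
    rw [← hBe0, hM, ← mulVec_mulVec]
    congr 1
    ext i; fin_cases i <;> simp [mulVec_diagonal, hc0]
  · refine ⟨(c 1)⁻¹, inv_ne_zero hc1, hinv _ _ ?_⟩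
    rw [← hBe1, hM, ← mulVec_mulVec]
    congr 1
    ext i; fin_cases i <;> simp [mulVec_diagonal, hc1]
  · refine ⟨(c 2)⁻¹, inv_ne_zero hc2, hinv _ _ ?_⟩
    rw [← hBe2, hM, ← mulVec_mulVec]
    congr 1
    ext i; fin_cases i <;> simp [mulVec_diagonal, hc2]
  · refine ⟨1, one_ne_zero, hinv _ _ ?_⟩
    rw [← hBc, hM, ← mulVec_mulVec]
    congr 1
    ext i; fin_cases i <;> simp [mulVec_diagonal]

/-- a unimodular matrix fixing all points of the projective plane is trivial -/
theorem scalar_one (M : SpecialLinearGroup (Fin 3) (ZMod 53))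
    (h : ∀ w, w ≠ 0 → prp w (M.1 *ᵥ w)) : M = 1 := by
  have nz : ∀ x y z : ZMod 53, (x ≠ 0 ∨ y ≠ 0 ∨ z ≠ 0) → (![x, y, z] : Fin 3 → ZMod 53) ≠ 0 := by
    intro x y z h h'
    have a := congrFun h' 0
    have b := congrFun h' 1
    have c := congrFun h' 2
    simp at a b c
    tauto
  obtain ⟨a, ha, h1⟩ := h ![1, 0, 0] (nz _ _ _ (by simp))
  obtain ⟨b, hb, h2⟩ := h ![0, 1, 0] (nz _ _ _ (by simp))
  obtain ⟨c, hc, h3⟩ := h ![0, 0, 1] (nz _ _ _ (by simp))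
  obtain ⟨d, hd, h4⟩ := h ![1, 1, 1] (nz _ _ _ (by simp))
  have hdet := M.2
  have g10 := congrFun h1 0
  have g11 := congrFun h1 1
  have g12 := congrFun h1 2
  have g20 := congrFun h2 0
  have g21 := congrFun h2 1
  have g22 := congrFun h2 2
  have g30 := congrFun h3 0
  have g31 := congrFun h3 1
  have g32 := congrFun h3 2
  have g40 := congrFun h4 0
  have g41 := congrFun h4 1
  have g42 := congrFun h4 2
  simp [mulVec, dotProduct, Fin.sum_univ_three, ha, hb, hc] at g10 g11 g12 g20 g21 g22 g30 g31 g32 g40 g41 g42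
  rw [Matrix.det_fin_three] at hdet
  simp [g11, g12, g20, g22, g30, g31] at hdet g40 g41 g42
  have e1 : M.1 0 0 = d⁻¹ := eq_inv_of_mul_eq_one_right g40.symm
  have e2 : M.1 1 1 = d⁻¹ := eq_inv_of_mul_eq_one_right g41.symm
  have e3 : M.1 2 2 = d⁻¹ := eq_inv_of_mul_eq_one_right g42.symm
  have h5 : d⁻¹ ^ 3 = 1 := by
    rw [← hdet]
    simp [e1, e2, e3]
    ring
  have h6 : d⁻¹ = 1 := by
    rw [← pow105 d⁻¹, show 105 = 3 * 35 by norm_num, pow_mul, h5, one_pow]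
  ext i j
  fin_cases i <;> fin_cases j <;> simp [g11, g12, g20, g22, g30, g31, e1, e2, e3, h6]

end OD

end

section
open Subgroup MulAction
open scoped Pointwise

namespace OD

theorem par2 {u w : Fin 2 → ZMod 53} (hu : u ≠ 0) :
    u 0 * w 1 - u 1 * w 0 = 0 ↔ ∃ k : ZMod 53, w = k • u := by
  constructor
  · intro h
    by_cases h0 : u 0 = 0
    · have h1 : u 1 ≠ 0 := by
        intro h1
        apply hu
        ext i; fin_cases i <;> simp [h0, h1]
      refine ⟨w 1 / u 1, ?_⟩
      ext i
      fin_cases i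
      · simp only [Fin.zero_eta, Pi.smul_apply, smul_eq_mul]
        field_simp
        linear_combination -h
      · simp only [Fin.mk_one, Pi.smul_apply, smul_eq_mul]
        field_simp
    · refine ⟨w 0 / u 0, ?_⟩
      ext i
      fin_cases i
      · simp only [Fin.zero_eta, Pi.smul_apply, smul_eq_mul]
        field_simp
      · simp only [Fin.mk_one, Pi.smul_apply, smul_eq_mul]
        field_simp
        linear_combination h
  · rintro ⟨k, rfl⟩
    simp only [Pi.smul_apply, smul_eq_mul]
    ring

namespace Geo

section
set_option linter.unusedSectionVars false
variable {G Ω : Type*} [Group G] [MulAction G Ω] [Finite G] [Finite Ω] {adj : Ω → Ω → Prop}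
  {E : Ω → Subgroup G}

theorem coordV (g : Geo adj E) (V : Ω) : ∃ c : G → Fin 2 → ZMod 53,
    (∀ a ∈ E V, ∀ b ∈ E V, c (a * b) = c a + c b) ∧
    (∀ a ∈ E V, ∀ b ∈ E V, c a = c b → a = b) ∧ (∀ w, ∃ a ∈ E V, c a = w) ∧
    ∃ δ : Ω → Fin 2 → ZMod 53, ∀ U, adj V U → δ U ≠ 0 ∧
      ∀ a ∈ E V, (a ∈ E U ↔ δ U 0 * c a 1 - δ U 1 * c a 0 = 0) := by
  classical
  obtain ⟨c, hb, hc⟩ := coord (E V) (g.cardE V) (fun a => Subtype.ext (g.exp53 a.2))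
  let c' : G → Fin 2 → ZMod 53 := fun a => if h : a ∈ E V then c ⟨a, h⟩ else 0
  have hc' : ∀ a (h : a ∈ E V), c' a = c ⟨a, h⟩ := fun a h => dif_pos h
  have hmul : ∀ a ∈ E V, ∀ b ∈ E V, c' (a * b) = c' a + c' b := by
    intro a ha b hb
    rw [hc' a ha, hc' b hb, hc' _ (mul_mem ha hb), ← hc]
    rfl
  have hinj : ∀ a ∈ E V, ∀ b ∈ E V, c' a = c' b → a = b := by
    intro a ha b hb' h
    rw [hc' a ha, hc' b hb'] at h
    exact congrArg Subtype.val (hb.1 h)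
  have h1 : c' 1 = 0 := by
    have := hmul 1 (one_mem _) 1 (one_mem _)
    rw [mul_one] at this
    exact left_eq_add.1 this
  have hpow : ∀ a ∈ E V, ∀ n : ℕ, c' (a ^ n) = (n : ZMod 53) • c' a := by
    intro a ha n
    induction n with
    | zero => simp [h1]
    | succ n ih => rw [pow_succ, hmul _ (pow_mem ha n) _ ha, ih, Nat.cast_succ, add_smul, one_smul]
  refine ⟨c', hmul, hinj, ?_, ?_⟩
  · intro w
    obtain ⟨⟨a, ha⟩, h⟩ := hb.2 w
    exact ⟨a, ha, by rw [hc' a ha, h]⟩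
  · have : ∀ U, ∃ d : G, adj V U → d ∈ E V ∧ d ≠ 1 ∧
        (∀ a, a ∈ E V → (a ∈ E U ↔ ∃ n : ℕ, a = d ^ n)) := by
      intro U
      by_cases h : adj V U
      · obtain ⟨d, hd⟩ := g.ex_gen h
        exact ⟨d, fun _ => hd⟩
      · exact ⟨1, fun h' => absurd h' h⟩
    choose d hd using this
    refine ⟨fun U => c' (d U), fun U hU => ?_⟩
    obtain ⟨p1, p2, p3⟩ := hd U hU
    have hne : c' (d U) ≠ 0 := by
      intro h
      rw [← h1] at h
      exact p2 (hinj _ p1 _ (one_mem _) h)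
    refine ⟨hne, fun a ha => ?_⟩
    show _ ↔ c' (d U) 0 * c' a 1 - c' (d U) 1 * c' a 0 = 0
    rw [p3 a ha, par2 hne]
    constructor
    · rintro ⟨n, rfl⟩
      exact ⟨n, hpow _ p1 n⟩
    · rintro ⟨k, hk⟩
      refine ⟨k.val, hinj _ ha _ (pow_mem p1 _) ?_⟩
      rw [hpow _ p1, ZMod.natCast_zmod_val, hk]

theorem coords (g : Geo adj E) (V : Ω) : ∃ r : Ω → Fin 3 → ZMod 53,
    (∀ x, r x ≠ 0) ∧
    (∀ w, w ≠ 0 → ∃ x, ¬ col adj V x ∧ prp w (r x)) ∧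
    (∀ x y, ¬ col adj V x → ¬ col adj V y → prp (r x) (r y) → x = y) ∧
    (∀ L, col adj V L → ∃ l : Fin 3 → ZMod 53, l ≠ 0 ∧ ∀ x, ¬ col adj V x →
      (adj L x ↔ l 0 * r x 0 + l 1 * r x 1 + l 2 * r x 2 = 0)) := by
  classical
  obtain ⟨c, hmul, hinj, hsurj, δ, hδ⟩ := g.coordV V
  obtain ⟨O, hO⟩ := g.ex_aff V
  have hex : ∀ x, ∃ a ∈ E V, aff adj V x → a • O = x := by
    intro x
    by_cases h : aff adj V x
    · obtain ⟨a, ha, h'⟩ := g.aff_trans hO h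
      exact ⟨a, ha, fun _ => h'⟩
    · exact ⟨1, one_mem _, fun h' => absurd h' h⟩
  choose α hαm hα using hex
  have hαO : ∀ a ∈ E V, α (a • O) = a := fun a ha =>
    g.aff_inj hO (hαm _) ha (hα _ (g.aff_smul hO ha))
  let r : Ω → Fin 3 → ZMod 53 := fun x =>
    if adj V x then ![δ x 0, δ x 1, 0] else ![c (α x) 0, c (α x) 1, 1]
  have hr1 : ∀ x, adj V x → r x = ![δ x 0, δ x 1, 0] := fun x h => if_pos h
  have hr2 : ∀ x, ¬ adj V x → r x = ![c (α x) 0, c (α x) 1, 1] := fun x h => if_neg h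
  have ext2 : ∀ u w : Fin 2 → ZMod 53, u 0 = w 0 → u 1 = w 1 → u = w := by
    intro u w h1 h2
    ext i; fin_cases i <;> assumption
  have hc1 : c 1 = 0 := by
    have := hmul 1 (one_mem _) 1 (one_mem _)
    rw [mul_one] at this
    exact left_eq_add.1 this
  have hinv : ∀ a ∈ E V, c a⁻¹ = - c a := by
    intro a ha
    have := hmul a ha a⁻¹ (inv_mem ha)
    rw [mul_inv_cancel, hc1] at this
    exact (neg_eq_of_add_eq_zero_right this.symm).symm
  -- points at infinity are determined by direction
  have hinf : ∀ U U', adj V U → adj V U' → δ U 0 * δ U' 1 - δ U 1 * δ U' 0 = 0 → U = U' := by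
    intro U U' h h' hdet
    by_contra hne
    obtain ⟨a, ha, hca⟩ := hsurj (δ U')
    have h1 : a ∈ E U := by rw [(hδ U h).2 a ha, hca]; exact hdet
    have h2 : a ∈ E U' := by rw [(hδ U' h').2 a ha, hca]; ring
    have h3 := g.inf3 hne (g.symm h) (g.symm h') a h1 h2 ha
    rw [h3, hc1] at hca
    exact (hδ U' h').1 hca.symm
  refine ⟨r, ?_, ?_, ?_, ?_⟩
  · intro x hx
    by_cases h : adj V x
    · rw [hr1 x h] at hx
      apply (hδ x h).1
      apply ext2
      · exact congrFun hx 0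
      · exact congrFun hx 1
    · rw [hr2 x h] at hx
      have := congrFun hx 2
      simp at this
  · intro w hw
    by_cases h : w 2 = 0
    · obtain ⟨a, ha, hca⟩ := hsurj ![w 0, w 1]
      obtain ⟨U, hU, haU⟩ := g.cover ha
      rw [(hδ U hU).2 a ha, par2 (hδ U hU).1] at haU
      obtain ⟨k, hk⟩ := haU
      refine ⟨U, g.adj_not_col hU, k, ?_, ?_⟩
      · rintro rfl
        rw [zero_smul, hca] at hk
        apply hw
        have e0 := congrFun hk 0
        have e1 := congrFun hk 1
        simp at e0 e1
        ext i; fin_cases i <;> simp [e0, e1, h]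
      · rw [hr1 U hU]
        rw [hca] at hk
        have e0 := congrFun hk 0
        have e1 := congrFun hk 1
        simp at e0 e1
        ext i; fin_cases i <;> simp [e0, e1, h]
    · obtain ⟨a, ha, hca⟩ := hsurj ![w 0 / w 2, w 1 / w 2]
      have haff := g.aff_smul hO ha
      refine ⟨a • O, haff.1, w 2, h, ?_⟩
      rw [hr2 _ haff.2, hαO a ha, hca]
      ext i
      fin_cases i <;> simp <;> field_simp
  · rintro x y hx hy ⟨k, hk, h⟩
    have e0 := congrFun h 0
    have e1 := congrFun h 1
    have e2 := congrFun h 2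
    by_cases hVx : adj V x <;> by_cases hVy : adj V y
    · rw [hr1 x hVx, hr1 y hVy] at e0 e1
      simp at e0 e1
      apply hinf x y hVx hVy
      rw [e0, e1]; ring
    · rw [hr1 x hVx, hr2 y hVy] at e2
      simp at e2
      exact absurd e2.symm hk
    · rw [hr2 x hVx, hr1 y hVy] at e2
      simp at e2
    · rw [hr2 x hVx, hr2 y hVy] at e0 e1 e2
      simp at e0 e1 e2
      rw [← e2, one_mul] at e0 e1
      have h3 : α x = α y := hinj _ (hαm x) _ (hαm y) (ext2 _ _ e0 e1)
      rw [← hα x ⟨hx, hVx⟩, ← hα y ⟨hy, hVy⟩, h3]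
  · intro L hL
    by_cases hLV : L = V
    · subst hLV
      refine ⟨![0, 0, 1], ?_, ?_⟩
      · intro h
        have := congrFun h 2
        simp at this
      · intro x hx
        by_cases h : adj L x
        · rw [hr1 x h]; simp [h]
        · rw [hr2 x h]; simp [h]
    · rcases hL with hL | ⟨U, hU, hUL⟩
      · exact absurd hL.symm hLV
      obtain ⟨x0, hx0, hx0U, -⟩ := g.ex_nb2 L U U
      have haff := g.line_aff (g.symm hU) (g.symm hUL) hLV hx0 hx0U
      refine ⟨![- δ U 1, δ U 0, δ U 1 * c (α x0) 0 - δ U 0 * c (α x0) 1], ?_, ?_⟩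
      · intro h
        have e0 := congrFun h 0
        have e1 := congrFun h 1
        simp at e0 e1
        exact (hδ U hU).1 (ext2 _ _ e1 e0)
      · intro x hx
        by_cases hVx : adj V x
        · rw [hr1 x hVx]
          have : adj L x ↔ x = U := by
            constructor
            · intro h
              exact g.nb_unique (Ne.symm hLV) hVx (g.symm h) hU hUL
            · rintro rfl
              exact g.symm hUL
          rw [this]
          simp
          constructor
          · rintro rfl; ring
          · intro h
            exact (hinf U x hU hVx (by linear_combination h)).symm
        · rw [hr2 x hVx]
          have hxa : aff adj V x := ⟨hx, hVx⟩
          have hxm : α x * (α x0)⁻¹ ∈ E V := mul_mem (hαm x) (inv_mem (hαm x0))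
          have h1 : adj L x ↔ α x * (α x0)⁻¹ ∈ E U := by
            have hb : (α x * (α x0)⁻¹) • x0 = x := by
              rw [← hα x0 haff, mul_smul, inv_smul_eq_iff.2 (by rw [hα x0 haff, hα x0 haff]), hα x hxa]
            constructor
            · intro h
              obtain ⟨b, hb1, hb2, hb3⟩ := g.line_trans (g.symm hU) (g.symm hUL) hLV hx0 hx0U h
                (fun h' => hVx (h' ▸ hU))
              rw [g.aff_inj haff hxm hb2 (hb.trans hb3.symm)]
              exact hb1
            · intro h
              rw [← hb]
              exact g.line_smul (g.symm hUL) h hx0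
          rw [h1, (hδ U hU).2 _ hxm, hmul _ (hαm x) _ (inv_mem (hαm x0)), hinv _ (hαm x0)]
          simp
          constructor <;> intro h <;> linear_combination h

end
end Geo
end OD

end

section
open Subgroup MulAction Matrix
open scoped Pointwise

namespace OD

theorem prp_symm {u v : Fin 3 → ZMod 53} (h : prp u v) : prp v u := by
  obtain ⟨c, hc, rfl⟩ := h
  exact ⟨c⁻¹, inv_ne_zero hc, by rw [smul_smul, inv_mul_cancel₀ hc, one_smul]⟩

theorem prp_trans {u v w : Fin 3 → ZMod 53} (h : prp u v) (h' : prp v w) : prp u w := by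
  obtain ⟨c, hc, rfl⟩ := h
  obtain ⟨d, hd, rfl⟩ := h'
  exact ⟨c * d, mul_ne_zero hc hd, by rw [smul_smul]⟩

theorem prp_mulVec (M : Matrix (Fin 3) (Fin 3) (ZMod 53)) {u v : Fin 3 → ZMod 53} (h : prp u v) :
    prp (M *ᵥ u) (M *ᵥ v) := by
  obtain ⟨c, hc, rfl⟩ := h
  exact ⟨c, hc, mulVec_smul _ _ _⟩

theorem det_of_dt (u v w : Fin 3 → ZMod 53) :
    (Matrix.of ![u, v, w]).det = dt u v w := by
  simp [Matrix.det_fin_three, dt]; ring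

theorem dt_ker {u v w l : Fin 3 → ZMod 53} (hl : l ≠ 0)
    (h1 : l 0 * u 0 + l 1 * u 1 + l 2 * u 2 = 0) (h2 : l 0 * v 0 + l 1 * v 1 + l 2 * v 2 = 0)
    (h3 : l 0 * w 0 + l 1 * w 1 + l 2 * w 2 = 0) : dt u v w = 0 := by
  rw [← det_of_dt, ← Matrix.exists_mulVec_eq_zero_iff]
  refine ⟨l, hl, ?_⟩
  ext i
  fin_cases i
  · simp [mulVec, dotProduct, Fin.sum_univ_three]; linear_combination h1
  · simp [mulVec, dotProduct, Fin.sum_univ_three]; linear_combination h2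
  · simp [mulVec, dotProduct, Fin.sum_univ_three]; linear_combination h3

theorem dt_dep {u v w : Fin 3 → ZMod 53} (h : dt u v w = 0) :
    ∃ a b c : ZMod 53, (a ≠ 0 ∨ b ≠ 0 ∨ c ≠ 0) ∧ a • u + b • v + c • w = 0 := by
  rw [← det_of_dt, ← Matrix.exists_vecMul_eq_zero_iff] at h
  obtain ⟨l, hl, h⟩ := h
  refine ⟨l 0, l 1, l 2, ?_, ?_⟩
  · by_contra hc
    push Not at hc
    apply hl
    ext i; fin_cases i
    · exact hc.1
    · exact hc.2.1
    · exact hc.2.2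
  · ext i
    have := congrFun h i
    simp [vecMul, dotProduct, Fin.sum_univ_three] at this
    simpa using this

theorem dt_prp {u v w u' v' w' : Fin 3 → ZMod 53} (hu : prp u u') (hv : prp v v') (hw : prp w w') :
    dt u v w = 0 ↔ dt u' v' w' = 0 := by
  obtain ⟨a, ha, rfl⟩ := hu
  obtain ⟨b, hb, rfl⟩ := hv
  obtain ⟨c, hc, rfl⟩ := hw
  have : dt (a • u') (b • v') (c • w') = a * b * c * dt u' v' w' := by
    simp only [dt, Pi.smul_apply, smul_eq_mul]; ring
  rw [this]
  simp [ha, hb, hc]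

namespace Geo

section
set_option linter.unusedSectionVars false
variable {G Ω : Type*} [Group G] [MulAction G Ω] [Finite G] [Finite Ω] {adj : Ω → Ω → Prop}
  {E : Ω → Subgroup G}

theorem dt_iff (g : Geo adj E) {V : Ω} {r : Ω → Fin 3 → ZMod 53}
    (R0 : ∀ x, r x ≠ 0)
    (R2 : ∀ x y, ¬ col adj V x → ¬ col adj V y → prp (r x) (r y) → x = y)
    (R3 : ∀ L, col adj V L → ∃ l : Fin 3 → ZMod 53, l ≠ 0 ∧ ∀ x, ¬ col adj V x →
      (adj L x ↔ l 0 * r x 0 + l 1 * r x 1 + l 2 * r x 2 = 0)) {x y z : Ω}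
    (hx : ¬ col adj V x) (hy : ¬ col adj V y) (hz : ¬ col adj V z) :
    dt (r x) (r y) (r z) = 0 ↔ ∃ L, adj L x ∧ adj L y ∧ adj L z := by
  have hLc : ∀ {L x}, adj L x → ¬ col adj V x → col adj V L := fun h h' => (g.col_adj h).2 h'
  constructor
  · intro h
    by_cases hxy : x = y
    · subst hxy
      rcases g.not_col hx hz with rfl | ⟨L, h1, h2⟩
      · obtain ⟨L, hL⟩ := g.ex_nb x
        exact ⟨L, g.symm hL, g.symm hL, g.symm hL⟩
      · exact ⟨L, g.symm h1, g.symm h1, h2⟩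
    · rcases g.not_col hx hy with h' | ⟨L, h1, h2⟩
      · exact absurd h' hxy
      have h1 := g.symm h1
      refine ⟨L, h1, h2, ?_⟩
      obtain ⟨l, hl, hLl⟩ := R3 L (hLc h1 hx)
      have e1 := (hLl x hx).1 h1
      have e2 := (hLl y hy).1 h2
      rw [hLl z hz]
      obtain ⟨a, b, c, hne, habc⟩ := dt_dep h
      have q0 := congrFun habc 0
      have q1 := congrFun habc 1
      have q2 := congrFun habc 2
      simp at q0 q1 q2
      have hc : c ≠ 0 := by
        rintro rfl
        rw [zero_smul, add_zero] at habc
        have ha : a ≠ 0 := by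
          rintro rfl
          rw [zero_smul, zero_add, smul_eq_zero] at habc
          rcases habc with rfl | h'
          · simp at hne
          · exact R0 _ h'
        have hb : b ≠ 0 := by
          rintro rfl
          rw [zero_smul, add_zero, smul_eq_zero] at habc
          rcases habc with rfl | h'
          · simp at hne
          · exact R0 _ h'
        apply hxy
        apply R2 x y hx hy
        have h5 : a • r x = (-b) • r y := by
          rw [neg_smul]; exact eq_neg_of_add_eq_zero_left habc
        refine ⟨a⁻¹ * (-b), mul_ne_zero (inv_ne_zero ha) (neg_ne_zero.2 hb), ?_⟩
        rw [← smul_smul, ← h5, smul_smul, inv_mul_cancel₀ ha, one_smul]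
      have : c * (l 0 * r z 0 + l 1 * r z 1 + l 2 * r z 2) = 0 := by
        linear_combination l 0 * q0 + l 1 * q1 + l 2 * q2 - a * e1 - b * e2
      exact (mul_eq_zero.1 this).resolve_left hc
  · rintro ⟨L, h1, h2, h3⟩
    obtain ⟨l, hl, hLl⟩ := R3 L (hLc h1 hx)
    exact dt_ker hl ((hLl x hx).1 h1) ((hLl y hy).1 h2) ((hLl z hz).1 h3)

theorem pt_faithful (g : Geo adj E) (V : Ω) {a : G} (h : ∀ x, ¬ col adj V x → a • x = x) : a = 1 := by
  apply g.faithful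
  intro L
  by_cases hL : col adj V L
  · obtain ⟨x, hx⟩ := g.ex_nb L
    obtain ⟨y, hy, hyx, -⟩ := g.ex_nb2 L x x
    have hx' := (g.col_adj hx).1 hL
    have hy' := (g.col_adj hy).1 hL
    have h1 := g.smul a hx
    have h2 := g.smul a hy
    rw [h x hx'] at h1
    rw [h y hy'] at h2
    exact g.nb_unique hyx (g.symm h2) h1 (g.symm hy) hx
  · exact h L hL

theorem emb (g : Geo adj E) : ∃ f : G →* SpecialLinearGroup (Fin 3) (ZMod 53), Function.Injective f := by
  classical
  have hne : Nonempty Ω := by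
    have := g.card
    exact (Nat.card_pos_iff.1 (by rw [this]; norm_num)).1
  obtain ⟨V⟩ := hne
  obtain ⟨r, R0, R1, R2, R3⟩ := g.coords V
  have hp : ∀ w, ∃ x, w ≠ 0 → ¬ col adj V x ∧ prp w (r x) := by
    intro w
    by_cases h : w = 0
    · exact ⟨V, fun h' => absurd h h'⟩
    · obtain ⟨x, hx⟩ := R1 w h
      exact ⟨x, fun _ => hx⟩
  choose p hp using hp
  have hpr : ∀ x, ¬ col adj V x → p (r x) = x := by
    intro x hx
    obtain ⟨h1, h2⟩ := hp (r x) (R0 x)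
    exact (R2 x _ hx h1 h2).symm
  have hpt : ∀ (a : G) {x : Ω}, ¬ col adj V x → ¬ col adj V (a • x) := by
    intro a x hx h
    exact hx (g.col_trans h (g.col_symm (g.col_smul a x)))
  have hex : ∀ a : G, ∃ M : SpecialLinearGroup (Fin 3) (ZMod 53),
      ∀ x, ¬ col adj V x → prp (r (a • x)) (M.1 *ᵥ r x) := by
    intro a
    let s : (Fin 3 → ZMod 53) → (Fin 3 → ZMod 53) := fun w => if w = 0 then 0 else r (a • p w)
    have hs0 : s 0 = 0 := if_pos rfl
    have hs : ∀ w, w ≠ 0 → s w = r (a • p w) := fun w hw => if_neg hw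
    have hM := ftpg (s := s) ?_ ?_
    · obtain ⟨M, hM⟩ := hM
      refine ⟨M, fun x hx => ?_⟩
      have := hM (r x) (R0 x)
      rwa [hs _ (R0 x), hpr x hx] at this
    · intro w
      constructor
      · intro h
        by_contra hw
        rw [hs w hw] at h
        exact R0 _ h
      · rintro rfl; exact hs0
    · intro u v w
      by_cases hu : u = 0
      · subst hu; rw [hs0]; simp [dt]
      by_cases hv : v = 0
      · subst hv; rw [hs0]; simp [dt]
      by_cases hw : w = 0
      · subst hw; rw [hs0]; simp [dt]
      rw [hs u hu, hs v hv, hs w hw]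
      obtain ⟨u1, u2⟩ := hp u hu
      obtain ⟨v1, v2⟩ := hp v hv
      obtain ⟨w1, w2⟩ := hp w hw
      rw [dt_prp u2 v2 w2, g.dt_iff R0 R2 R3 u1 v1 w1,
        g.dt_iff R0 R2 R3 (hpt a u1) (hpt a v1) (hpt a w1)]
      constructor
      · rintro ⟨L, h1, h2, h3⟩
        exact ⟨a • L, g.smul a h1, g.smul a h2, g.smul a h3⟩
      · rintro ⟨L, h1, h2, h3⟩
        refine ⟨a⁻¹ • L, ?_, ?_, ?_⟩ <;> rw [← g.adj_iff a, smul_inv_smul] <;> assumption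
  choose f hf using hex
  have huniq : ∀ M N : SpecialLinearGroup (Fin 3) (ZMod 53),
      (∀ x, ¬ col adj V x → prp (M.1 *ᵥ r x) (N.1 *ᵥ r x)) → M = N := by
    intro M N h
    have h1 : M⁻¹ * N = 1 := by
      apply scalar_one
      intro w hw
      obtain ⟨hx, hwx⟩ := hp w hw
      have h2 := prp_mulVec (M⁻¹).1 (h _ hx)
      have e1 : (M⁻¹).1 *ᵥ (M.1 *ᵥ r (p w)) = r (p w) := by
        have hm : (M⁻¹).1 * M.1 = 1 := congrArg Subtype.val (inv_mul_cancel M)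
        rw [mulVec_mulVec, hm, one_mulVec]
      have e2 : (M⁻¹).1 *ᵥ (N.1 *ᵥ r (p w)) = (M⁻¹ * N).1 *ᵥ r (p w) := by
        rw [mulVec_mulVec]; rfl
      rw [e1, e2] at h2
      exact prp_trans hwx (prp_trans h2 (prp_symm (prp_mulVec _ hwx)))
    exact inv_mul_eq_one.1 h1
  refine ⟨MonoidHom.mk' f ?_, ?_⟩
  · intro a b
    apply huniq
    intro x hx
    have h1 := hf (a * b) x hx
    have h2 := hf a (b • x) (hpt b hx)
    have h3 := prp_mulVec (f a).1 (hf b x hx)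
    rw [mulVec_mulVec] at h3
    have h3 : prp ((f a).1 *ᵥ r (b • x)) ((f a * f b).1 *ᵥ r x) := h3
    rw [mul_smul] at h1
    exact prp_trans (prp_symm h1) (prp_trans h2 h3)
  · rw [injective_iff_map_eq_one]
    intro a ha
    have ha : f a = 1 := ha
    apply g.pt_faithful V
    intro x hx
    apply R2 _ _ (hpt a hx) hx
    have := hf a x hx
    have h1 : (f a).1 = 1 := congrArg Subtype.val ha
    rwa [h1, one_mulVec] at this

end
end Geo

end OD

end

section
open Subgroup MulAction Matrix
open scoped MatrixGroups

namespace OD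

theorem card_SL : Nat.card (SpecialLinearGroup (Fin 3) (ZMod 53)) =
    2 ^ 5 * 3 ^ 3 * 7 * 13 ^ 2 * 53 ^ 3 * 409 := by
  let φ : GL (Fin 3) (ZMod 53) →* (ZMod 53)ˣ := Matrix.GeneralLinearGroup.det
  have hsurj : Function.Surjective φ := Matrix.GeneralLinearGroup.det_surjective
  have h1 : φ.ker.index = 52 := by
    rw [Subgroup.index_ker, MonoidHom.range_eq_top.2 hsurj, Subgroup.card_top,
      Nat.card_eq_fintype_card, ZMod.card_units]
  have h2 := φ.ker.card_mul_index
  have h3 : Nat.card (GL (Fin 3) (ZMod 53)) = (53 ^ 3 - 1) * (53 ^ 3 - 53) * (53 ^ 3 - 53 ^ 2) := by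
    rw [Matrix.card_GL_field, Fin.prod_univ_three]
    simp [ZMod.card]
  let ι : SpecialLinearGroup (Fin 3) (ZMod 53) →* GL (Fin 3) (ZMod 53) :=
    Matrix.SpecialLinearGroup.toGL
  have hι : Function.Injective ι := Matrix.SpecialLinearGroup.toGL_injective
  have h4 : ι.range = φ.ker := by
    ext M
    constructor
    · rintro ⟨N, rfl⟩
      rw [MonoidHom.mem_ker]
      ext
      exact N.2
    · intro h
      rw [MonoidHom.mem_ker] at h
      refine ⟨⟨M.1, congrArg Units.val h⟩, ?_⟩
      ext i j
      rfl
  have h5 : Nat.card (SpecialLinearGroup (Fin 3) (ZMod 53)) = Nat.card φ.ker := by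
    rw [← h4]
    exact Nat.card_congr (MonoidHom.ofInjective hι).toEquiv
  rw [h1, h3] at h2
  rw [h5]
  omega

theorem center_SL : Subgroup.center (SpecialLinearGroup (Fin 3) (ZMod 53)) = ⊥ := by
  rw [eq_bot_iff]
  intro A hA
  rw [Matrix.SpecialLinearGroup.mem_center_iff] at hA
  obtain ⟨c, hc, h⟩ := hA
  rw [Fintype.card_fin] at hc
  have h6 : c = 1 := by
    rw [← pow105 c, show 105 = 3 * 35 by norm_num, pow_mul, hc, one_pow]
  rw [Subgroup.mem_bot]
  ext i j
  rw [← h, h6]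
  simp

theorem final (G : Type*) [Group G] [Finite G]
    (hcard : Nat.card G = 2 ^ 5 * 3 ^ 3 * 7 * 13 ^ 2 * 53 ^ 3 * 409)
    (h : ∃ f : G →* SpecialLinearGroup (Fin 3) (ZMod 53), Function.Injective f) :
    Nonempty (G ≃* PSL(3, ZMod 53)) := by
  obtain ⟨f, hf⟩ := h
  have hb : Function.Bijective f :=
    (Nat.bijective_iff_injective_and_card f).2 ⟨hf, by rw [hcard, card_SL]⟩
  let π := QuotientGroup.mk' (Subgroup.center (SpecialLinearGroup (Fin 3) (ZMod 53)))
  have hπ : Function.Bijective π := by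
    refine ⟨?_, QuotientGroup.mk'_surjective _⟩
    rw [← MonoidHom.ker_eq_bot_iff, QuotientGroup.ker_mk', center_SL]
  exact ⟨(MulEquiv.ofBijective f hb).trans (MulEquiv.ofBijective π hπ)⟩

end OD


end

theorem L3_53_OD_characterizable (G : Type*) [Group G] [Finite G]
    (hcard : Nat.card G = 2 ^ 5 * 3 ^ 3 * 7 * 13 ^ 2 * 53 ^ 3 * 409)
    (hdeg2 : primeGraphDeg G 2 = 3)
    (hdeg3 : primeGraphDeg G 3 = 2)
    (hdeg7 : primeGraphDeg G 7 = 1)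
    (hdeg13 : primeGraphDeg G 13 = 3)
    (hdeg53 : primeGraphDeg G 53 = 2)
    (hdeg409 : primeGraphDeg G 409 = 1) :
    Nonempty (G ≃* PSL(3, ZMod 53)) := by
  exact OD.final G hcard (OD.geo (OD.mkHyp hcard hdeg2 hdeg3 hdeg7 hdeg13 hdeg409)).emb
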